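/- arXiv:2401.03438 — 4 statements merged into one kernel-verified Lean document; each statement's English description precedes it below -/
import Mathlib

section
/- Let p : ℂ → ℂ be an even entire function and let q : ℂ → ℂ be the entire function with p(z) = q(z²) for all z ∈ ℂ (which exists since p is even). If the restriction of p to ℝ is slowly decreasing (as a function of one real variable), then the function ℝⁿ → ℂ, ξ ↦ q(ξ₁² + ⋯ + ξₙ²), is slowly decreasing; this function is the restriction to ℝⁿ of the entire function p(√(ζ²)), ζ² = Σ_{j=1}^{n} ζ_j². -/
open MeasureTheory Filter Set

/-- `F` is slowly decreasing: there is `A > 0` such that for every `ξ`,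
`sup { |F η| : |η - ξ| < A log(2 + |ξ|) } > (A + |ξ|)^(-A)`. -/
def SlowlyDecreasing {E : Type*} [NormedAddCommGroup E] (F : E → ℂ) : Prop :=
  ∃ A > 0, ∀ ξ : E, ∃ η : E,
    ‖η - ξ‖ < A * Real.log (2 + ‖ξ‖) ∧ (A + ‖ξ‖) ^ (-A) < ‖F η‖

/-- Let `p : ℂ → ℂ` be an even entire function, and `q : ℂ → ℂ` the entire function
with `p(z) = q(z²)`.  If the restriction of `p` to `ℝ` is slowly decreasing, then
`ξ ↦ q(ξ₁² + ⋯ + ξₙ²)` (the restriction to `ℝⁿ` of `p(√(ζ²))`) is slowly decreasing. -/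
theorem slowlyDecreasing_radial_of_even (n : ℕ) (hn : 0 < n)
    (p q : ℂ → ℂ) (hp : Differentiable ℂ p) (hq : Differentiable ℂ q)
    (heven : ∀ z : ℂ, p (-z) = p z) (hpq : ∀ z : ℂ, p z = q (z ^ 2))
    (hsd : SlowlyDecreasing (fun x : ℝ => p (x : ℂ))) :
    SlowlyDecreasing (fun ξ : EuclideanSpace ℝ (Fin n) =>
      q (((∑ i, ξ i ^ 2 : ℝ)) : ℂ)) := by
  obtain ⟨A, hA, h⟩ := hsd
  refine ⟨A, hA, fun ξ => ?_⟩
  obtain ⟨u, hu, hξ⟩ : ∃ u : EuclideanSpace ℝ (Fin n), ‖u‖ = 1 ∧ ξ = ‖ξ‖ • u := by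
    by_cases h0 : ξ = 0
    · refine ⟨EuclideanSpace.single ⟨0, hn⟩ 1, by simp, by simp [h0]⟩
    · have h1 : ‖ξ‖ ≠ 0 := norm_ne_zero_iff.mpr h0
      refine ⟨‖ξ‖⁻¹ • ξ, ?_, ?_⟩
      · rw [norm_smul, norm_inv, norm_norm, inv_mul_cancel₀ h1]
      · rw [smul_smul, mul_inv_cancel₀ h1, one_smul]
  obtain ⟨y, hy1, hy2⟩ := h ‖ξ‖
  rw [norm_norm] at hy1 hy2
  refine ⟨y • u, ?_, ?_⟩
  · have h2 : y • u - ξ = (y - ‖ξ‖) • u := by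
      rw [sub_smul, ← hξ]
    rw [h2, norm_smul, hu, mul_one]
    exact hy1
  · have h3 : (∑ i, (y • u) i ^ 2 : ℝ) = y ^ 2 := by
      rw [← EuclideanSpace.real_norm_sq_eq, norm_smul, hu, mul_one, Real.norm_eq_abs, sq_abs]
    simp only [h3]
    simp only [hpq] at hy2
    rw [Complex.ofReal_pow]
    exact hy2
end

section
/- Let p : ℂ → ℂ be an even entire function and let q̃ : ℂ → ℂ be the entire function with p(z) = q̃(z²) for all z ∈ ℂ. Let α ≥ 0 and define q(x) = x^α p(x) for x > 0. Assume there exist constants C > 0 and A, B > 0 (with B large enough that 2^{−α} C > B^{−α} and B ≤ A·log 2) such that for every x ≥ B, sup{ |q(y)| : y > 0, |y − x| < B } > C·x^(−A). Then the function ℝⁿ → ℂ, ξ ↦ q̃(ξ₁² + ⋯ + ξₙ²) (the restriction to ℝⁿ of p(√(ζ²)), ζ² = Σ ζ_j²), is slowly decreasing. -/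
open MeasureTheory Filter Set

/-- Let `p : ℂ → ℂ` be an even entire function and `q̃ : ℂ → ℂ` the entire function with
`p(z) = q̃(z²)`.  Let `α ≥ 0` and `q(x) = x^α p(x)` for `x > 0`.  If there are constants
`C > 0` and `A, B > 0` with `2^{-α} C > B^{-α}` and `B ≤ A log 2` such that
`sup { |q(y)| : y > 0, |y - x| < B } > C x^{-A}` for every `x ≥ B`, then
`ξ ↦ q̃(ξ₁² + ⋯ + ξₙ²)` (the restriction to `ℝⁿ` of `p(√(ζ²))`) is slowly decreasing. -/
theorem slowlyDecreasing_radial_of_weighted_condition (n : ℕ) (hn : 0 < n)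
    (p qt : ℂ → ℂ) (hp : Differentiable ℂ p) (hqt : Differentiable ℂ qt)
    (heven : ∀ z : ℂ, p (-z) = p z) (hpqt : ∀ z : ℂ, p z = qt (z ^ 2))
    (α : ℝ) (hα : 0 ≤ α)
    (C A B : ℝ) (hC : 0 < C) (hA : 0 < A) (hB : 0 < B)
    (hBα : B ^ (-α) < (2 : ℝ) ^ (-α) * C) (hBA : B ≤ A * Real.log 2)
    (hq : ∀ x : ℝ, B ≤ x → ∃ y : ℝ, 0 < y ∧ |y - x| < B ∧
      C * x ^ (-A) < ‖((y ^ α : ℝ) : ℂ) * p (y : ℂ)‖) :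
    SlowlyDecreasing (fun ξ : EuclideanSpace ℝ (Fin n) =>
      qt (((∑ i, ξ i ^ 2 : ℝ)) : ℂ)) := by
  have hCi : 0 < 1 / C := by positivity
  obtain ⟨D, hD⟩ : ∃ D, D = 2 * A + 2 * B + α + 1 + 1 / C := ⟨_, rfl⟩
  have hD0 : 0 < D := by rw [hD]; positivity
  refine ⟨D, hD0, fun ξ => ?_⟩
  have hr : 0 ≤ ‖ξ‖ := norm_nonneg ξ
  obtain ⟨u, hu, hξ⟩ : ∃ u : EuclideanSpace ℝ (Fin n), ‖u‖ = 1 ∧ ξ = ‖ξ‖ • u := by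
    by_cases h : ξ = 0
    · exact ⟨EuclideanSpace.single ⟨0, hn⟩ 1, by simp, by simp [h]⟩
    · have h' : ‖ξ‖ ≠ 0 := norm_ne_zero_iff.mpr h
      refine ⟨‖ξ‖⁻¹ • ξ, ?_, ?_⟩
      · rw [norm_smul, norm_inv, norm_norm, inv_mul_cancel₀ h']
      · rw [smul_smul, mul_inv_cancel₀ h', one_smul]
  obtain ⟨r, hrdef⟩ : ∃ r, r = ‖ξ‖ := ⟨_, rfl⟩
  rw [← hrdef] at hr hξ ⊢
  obtain ⟨y, hy, hyx, hlt⟩ := hq (r + B) (by linarith)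
  rw [abs_lt] at hyx
  refine ⟨y • u, ?_, ?_⟩
  · have h1 : ‖y • u - ξ‖ = |y - r| := by
      rw [hξ, ← sub_smul, norm_smul, hu, mul_one, Real.norm_eq_abs]
    have h2 : |y - r| < 2 * B := by rw [abs_lt]; constructor <;> linarith
    have hl2 : 0 < Real.log 2 := Real.log_pos (by norm_num)
    have h3 : Real.log 2 ≤ Real.log (2 + r) := Real.log_le_log (by norm_num) (by linarith)
    rw [h1]
    calc |y - r| < 2 * B := h2
      _ ≤ (2 * A) * Real.log 2 := by linarith
      _ ≤ D * Real.log 2 := by gcongr; linarith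
      _ ≤ D * Real.log (2 + r) := by gcongr
  · have hs : (∑ i, (y • u) i ^ 2 : ℝ) = y ^ 2 := by
      have := EuclideanSpace.real_norm_sq_eq (y • u)
      rw [← this, norm_smul, hu, mul_one, Real.norm_eq_abs, sq_abs]
    have hF : qt (((∑ i, (y • u) i ^ 2 : ℝ)) : ℂ) = p y := by
      rw [hs, hpqt]; push_cast; rfl
    show _ < ‖qt (((∑ i, (y • u) i ^ 2 : ℝ)) : ℂ)‖
    rw [hF]
    have hs1 : 1 ≤ D + r := by linarith
    have hs0 : 0 < D + r := by linarith
    have hya : 0 ≤ y ^ α := Real.rpow_nonneg hy.le _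
    rw [norm_mul, Complex.norm_real, Real.norm_of_nonneg hya] at hlt
    have hC1 : (D + r)⁻¹ ≤ C := by
      rw [inv_le_comm₀ hs0 hC, ← one_div]; linarith
    have e1 : (D + r) ^ (-A) ≤ (r + B) ^ (-A) :=
      Real.rpow_le_rpow_of_nonpos (by linarith) (by linarith) (by linarith)
    have e2 : y ^ α ≤ (D + r) ^ α := Real.rpow_le_rpow hy.le (by linarith) hα
    have e0 : 0 < (D + r) ^ (-A) := Real.rpow_pos_of_pos hs0 _
    have key : (D + r) ^ α * (D + r) ^ (-D) < (D + r) ^ α * ‖p y‖ := by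
      calc (D + r) ^ α * (D + r) ^ (-D) = (D + r) ^ (α + -D) := (Real.rpow_add hs0 _ _).symm
        _ ≤ (D + r) ^ (-1 + -A) := Real.rpow_le_rpow_of_exponent_le hs1 (by linarith)
        _ = (D + r)⁻¹ * (D + r) ^ (-A) := by rw [Real.rpow_add hs0, Real.rpow_neg_one]
        _ ≤ C * (D + r) ^ (-A) := by gcongr
        _ ≤ C * (r + B) ^ (-A) := by gcongr
        _ < y ^ α * ‖p y‖ := hlt
        _ ≤ (D + r) ^ α * ‖p y‖ := by gcongr
    exact lt_of_mul_lt_mul_left key (Real.rpow_nonneg hs0.le _)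
end

section
/- Let ν ∈ ℂ with Re ν > −1 and α ∈ ℂ. Let φ be a smooth function on (0, ∞) with bounded support such that φ(s) = s^{ν+1}(1 − s²)^α for all s in some interval (0, δ), δ > 0. Then for every real A, ∫₀^∞ φ(s) J_ν(rs) ds = o(r^{−A}) as r → ∞. -/
open MeasureTheory Filter Set

/-- The Bessel function of the first kind `J_ν(x)`, for `x > 0` defined by the series
`Σ_{k≥0} (-1)^k / (k! Γ(ν+k+1)) (x/2)^{2k+ν}`, powers via the real logarithm of `x/2`. -/
noncomputable def besselJ (ν : ℂ) (x : ℝ) : ℂ :=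
  ∑' k : ℕ, ((-1) ^ k / ((Nat.factorial k : ℂ) * Complex.Gamma (ν + k + 1))) *
    ((x / 2 : ℂ) ^ (2 * (k : ℂ) + ν))


noncomputable def besselCoeff (ν : ℂ) (k : ℕ) : ℂ :=
  (-1) ^ k / ((Nat.factorial k : ℂ) * Complex.Gamma (ν + k + 1))

noncomputable def besselF (ν : ℂ) (t : ℝ) : ℂ := ∑' k : ℕ, besselCoeff ν k * (t : ℂ) ^ k

lemma bc_ne (ν : ℂ) (hν : -1 < ν.re) (k : ℕ) : ν + k + 1 ≠ 0 := by
  intro h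
  have := congrArg Complex.re h
  simp at this
  have h2 : (0:ℝ) ≤ k := Nat.cast_nonneg k
  linarith

lemma bc_gamma_ne (ν : ℂ) (hν : -1 < ν.re) (k : ℕ) : Complex.Gamma (ν + k + 1) ≠ 0 := by
  apply Complex.Gamma_ne_zero_of_re_pos
  simp
  have h2 : (0:ℝ) ≤ k := Nat.cast_nonneg k
  linarith

lemma bc_succ (ν : ℂ) (hν : -1 < ν.re) (k : ℕ) :
    besselCoeff ν (k + 1) = -besselCoeff ν k / ((k + 1) * (ν + k + 1)) := by
  have h1 := bc_ne ν hν k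
  have h2 := bc_gamma_ne ν hν k
  have h3 : Complex.Gamma (ν + (k + 1 : ℕ) + 1) = (ν + k + 1) * Complex.Gamma (ν + k + 1) := by
    rw [← Complex.Gamma_add_one _ h1]; push_cast; ring_nf
  have h4 : (k.factorial : ℂ) ≠ 0 := by exact_mod_cast k.factorial_ne_zero
  have h5 : (k + 1 : ℂ) ≠ 0 := by exact_mod_cast k.succ_ne_zero
  unfold besselCoeff
  rw [h3, Nat.factorial_succ, pow_succ]
  push_cast
  field_simp

lemma bc_shift (ν : ℂ) (k : ℕ) :
    (k + 1) * besselCoeff ν (k + 1) = -besselCoeff (ν + 1) k := by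
  have h4 : (k.factorial : ℂ) ≠ 0 := by exact_mod_cast k.factorial_ne_zero
  have h5 : (k + 1 : ℂ) ≠ 0 := by exact_mod_cast k.succ_ne_zero
  unfold besselCoeff
  have : ν + (k + 1 : ℕ) + 1 = ν + 1 + k + 1 := by push_cast; ring
  rw [this, Nat.factorial_succ, pow_succ]
  push_cast
  by_cases h : Complex.Gamma (ν + 1 + k + 1) = 0
  · simp [h]
  field_simp

lemma bc_ne_zero (ν : ℂ) (hν : -1 < ν.re) (k : ℕ) : besselCoeff ν k ≠ 0 := by
  have h4 : (k.factorial : ℂ) ≠ 0 := by exact_mod_cast k.factorial_ne_zero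
  unfold besselCoeff
  exact div_ne_zero (by simp) (mul_ne_zero h4 (bc_gamma_ne ν hν k))

lemma bc_summable (ν : ℂ) (hν : -1 < ν.re) (R : ℝ) :
    Summable fun k : ℕ => ‖besselCoeff ν k‖ * |R| ^ k := by
  by_cases hR : R = 0
  · subst hR
    apply summable_of_ne_finset_zero (s := {0})
    intro b hb
    simp at hb
    simp [hb]
  have hR' : 0 < |R| := abs_pos.mpr hR
  refine summable_of_ratio_test_tendsto_lt_one (l := 0) one_pos ?_ ?_
  · exact Eventually.of_forall fun k => by
      have := bc_ne_zero ν hν k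
      positivity
  · have key : Tendsto (fun k : ℕ => |R| * (1 / ((k : ℝ) + 1)) * (1 / (ν.re + 1))) atTop (nhds 0) := by
      have := (tendsto_one_div_add_atTop_nhds_zero_nat (𝕜 := ℝ)).const_mul |R|
      have := this.mul_const (1 / (ν.re + 1))
      simpa using this
    refine squeeze_zero (fun k => by positivity) (fun k => ?_) key
    have hc := norm_pos_iff.mpr (bc_ne_zero ν hν k)
    rw [bc_succ ν hν k]
    have hk : (0:ℝ) < k + 1 := by positivity
    have hn : ν.re + 1 ≤ ‖ν + k + 1‖ := by
      refine le_trans ?_ (Complex.re_le_norm _)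
      simp
    have hn0 : 0 < ν.re + 1 := by linarith
    have hk' : ‖(k + 1 : ℂ)‖ = k + 1 := by
      have : (k + 1 : ℂ) = ((k + 1 : ℝ) : ℂ) := by push_cast; rfl
      rw [this, Complex.norm_real, Real.norm_of_nonneg hk.le]
    have e : ‖‖-besselCoeff ν k / ((k + 1) * (ν + k + 1))‖ * |R| ^ (k + 1)‖ /
        ‖‖besselCoeff ν k‖ * |R| ^ k‖ = |R| * (1 / ((k:ℝ) + 1)) * (1 / ‖ν + k + 1‖) := by
      simp only [norm_mul, norm_div, norm_neg, norm_pow, hk', Real.norm_eq_abs, abs_abs, abs_norm, abs_of_pos hk]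
      have := hn0.trans_le hn
      field_simp
      rw [pow_succ]
    rw [e]
    gcongr

lemma bF_summable (ν : ℂ) (hν : -1 < ν.re) (t : ℝ) :
    Summable fun k : ℕ => besselCoeff ν k * (t : ℂ) ^ k := by
  apply Summable.of_norm
  simpa using bc_summable ν hν t

lemma bF_hasDerivAt (ν : ℂ) (hν : -1 < ν.re) (t : ℝ) :
    HasDerivAt (besselF ν) (-besselF (ν + 1) t) t := by
  have hν1 : -1 < (ν + 1).re := by simp; linarith
  have hs := bc_summable (ν + 1) hν1 (|t| + 1)
  have hs2 : Summable (fun k : ℕ => ‖besselCoeff ν k‖ * k * |(|t| + 1)| ^ (k - 1)) := by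
    rw [← summable_nat_add_iff 1]
    refine hs.congr fun k => ?_
    have := congrArg norm (bc_shift ν k)
    rw [norm_mul, norm_neg] at this
    have hk' : ‖(k + 1 : ℂ)‖ = k + 1 := by
      have : (k + 1 : ℂ) = ((k + 1 : ℝ) : ℂ) := by push_cast; rfl
      rw [this, Complex.norm_real, Real.norm_of_nonneg (by positivity)]
    rw [← this, hk']
    simp
    left; ring
  have h := hasDerivAt_tsum_of_isPreconnected (𝕜 := ℝ) (t := Metric.ball (0:ℝ) (|t| + 1))
    (g := fun (k : ℕ) (y : ℝ) => besselCoeff ν k * (y : ℂ) ^ k)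
    (g' := fun (k : ℕ) (y : ℝ) => besselCoeff ν k * (k * (y : ℂ) ^ (k - 1)))
    (y₀ := 0) (y := t) hs2 Metric.isOpen_ball (convex_ball _ _).isPreconnected
    (fun k y _ => by
      have h1 := ((hasDerivAt_pow k (y : ℂ)).comp_ofReal).const_mul (besselCoeff ν k)
      exact h1)
    (fun k y hy => by
      have hy' : |y| ≤ |(|t| + 1)| := by
        rw [abs_of_pos (by positivity : 0 < |t| + 1)]
        simpa using (Metric.mem_ball.mp hy).le
      simp only [norm_mul, norm_pow, Complex.norm_real, Real.norm_eq_abs, Complex.norm_natCast]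
      rw [← mul_assoc]
      gcongr)
    (by simp; positivity) (bF_summable ν hν 0) (by simp)
  refine HasDerivAt.congr_deriv h ?_
  symm
  rw [tsum_eq_zero_add']
  · simp only [Nat.cast_zero, zero_mul, mul_zero, zero_add, Nat.add_sub_cancel]
    unfold besselF
    rw [← tsum_neg]
    refine tsum_congr fun k => ?_
    rw [← neg_mul, ← bc_shift ν k]
    push_cast; ring
  · have := (bF_summable (ν + 1) hν1 t).neg
    refine this.congr fun k => ?_
    rw [← neg_mul, ← bc_shift ν k, Nat.add_sub_cancel]
    push_cast; ring

lemma bF_rec (ν : ℂ) (hν : -1 < ν.re) (t : ℝ) :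
    besselF ν t = (ν + 1) * besselF (ν + 1) t - t * besselF (ν + 2) t := by
  have hν1 : -1 < (ν + 1).re := by simp; linarith
  have hν2 : -1 < (ν + 2).re := by simp; linarith
  have e1 := (bF_summable (ν + 1) hν1 t)
  have e2 := (bF_summable (ν + 2) hν2 t)
  have key : ∀ k : ℕ, besselCoeff ν (k + 1) =
      (ν + 1) * besselCoeff (ν + 1) (k + 1) - besselCoeff (ν + 2) k := by
    intro k
    have hg : Complex.Gamma (ν + 2 + k + 1) = (ν + k + 2) * Complex.Gamma (ν + 1 + k + 1) := by
      have : ν + 2 + k + 1 = (ν + 1 + k + 1) + 1 := by ring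
      rw [this, Complex.Gamma_add_one _ (bc_ne _ hν1 k)]; ring
    have a1 := bc_shift ν k
    have a2 := bc_shift (ν + 1) k
    have h5 : (k + 1 : ℂ) ≠ 0 := by exact_mod_cast k.succ_ne_zero
    have a3 : besselCoeff (ν + 1) k = (ν + k + 2) * besselCoeff (ν + 2) k := by
      unfold besselCoeff
      have := bc_gamma_ne _ hν2 k
      have := bc_gamma_ne _ hν1 k
      have : (k.factorial : ℂ) ≠ 0 := by exact_mod_cast k.factorial_ne_zero
      have h6 : ν + k + 2 ≠ 0 := by
        have := bc_ne _ hν1 k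
        intro h; apply this; rw [← h]; ring
      rw [hg]
      field_simp
    have h12 : ν + 1 + 1 = ν + 2 := by ring
    rw [h12] at a2
    apply mul_left_cancel₀ h5
    rw [mul_sub, a1, mul_left_comm, a2, a3]
    ring
  have key0 : besselCoeff ν 0 = (ν + 1) * besselCoeff (ν + 1) 0 := by
    unfold besselCoeff
    have h0 : ν + 1 ≠ 0 := by simpa using bc_ne ν hν 0
    have := bc_gamma_ne ν hν 0
    have hg : Complex.Gamma (ν + 1 + 1) = (ν + 1) * Complex.Gamma (ν + 1) :=
      Complex.Gamma_add_one _ h0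
    simp at this ⊢
    rw [hg]
    field_simp
  have e1' := (summable_nat_add_iff 1).mpr e1
  unfold besselF
  rw [(bF_summable ν hν t).tsum_eq_zero_add, e1.tsum_eq_zero_add, mul_add, ← tsum_mul_left,
    ← tsum_mul_left, key0, add_sub_assoc, ← Summable.tsum_sub (e1'.mul_left _) (e2.mul_left _)]
  congr 1
  · simp
  · refine tsum_congr fun k => ?_
    rw [key]; ring

lemma bF_bounded (ν : ℂ) (hν : 0 < ν.re) : ∃ C, ∀ t : ℝ, 0 ≤ t → ‖besselF ν t‖ ≤ C := by
  have h0 : -1 < ν.re := by linarith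
  have h1 : -1 < (ν + 1).re := by simp; linarith
  have hd : ∀ t : ℝ, HasDerivAt (fun t => ‖besselF ν t‖ ^ 2 + t * ‖besselF (ν + 1) t‖ ^ 2)
      (-(2 * ν.re + 1) * ‖besselF (ν + 1) t‖ ^ 2) t := by
    intro t
    have d1 := (bF_hasDerivAt ν h0 t).norm_sq
    have d2 := (bF_hasDerivAt (ν + 1) h1 t).norm_sq
    have d3 := d1.add ((hasDerivAt_id t).mul d2)
    refine HasDerivAt.congr_deriv d3 ?_
    have hr := bF_rec ν h0 t
    have h12 : ν + 1 + 1 = ν + 2 := by ring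
    rw [h12]
    have r1 := congrArg Complex.re hr
    have r2 := congrArg Complex.im hr
    simp at r1 r2
    simp only [Complex.inner, ← Complex.normSq_eq_norm_sq, Complex.normSq_apply]
    simp
    rw [r1, r2]
    ring
  have ha : AntitoneOn (fun t => ‖besselF ν t‖ ^ 2 + t * ‖besselF (ν + 1) t‖ ^ 2) (Ici 0) := by
    refine antitoneOn_of_deriv_nonpos (convex_Ici 0)
      (fun t _ => (hd t).continuousAt.continuousWithinAt)
      (fun t _ => (hd t).differentiableAt.differentiableWithinAt) fun t _ => ?_
    rw [(hd t).deriv]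
    have : 0 ≤ (2 * ν.re + 1) * ‖besselF (ν + 1) t‖ ^ 2 := by positivity
    linarith
  refine ⟨‖besselF ν 0‖, fun t ht => ?_⟩
  have := ha (by simp : (0:ℝ) ∈ Ici 0) (by simpa using ht : t ∈ Ici 0) ht
  simp at this
  have h2 : 0 ≤ t * ‖besselF (ν + 1) t‖ ^ 2 := by positivity
  exact le_of_sq_le_sq (by linarith) (norm_nonneg _) 

lemma bF_decay (ν : ℂ) (hν : 0 < ν.re) (n : ℕ) :
    (∃ C, ∀ t : ℝ, 0 ≤ t → t ^ n * ‖besselF (ν + (2 * n : ℕ)) t‖ ≤ C) ∧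
    (∃ C, ∀ t : ℝ, 0 ≤ t → t ^ n * ‖besselF (ν + (2 * n + 1 : ℕ)) t‖ ≤ C) := by
  have step : ∀ (μ : ℂ) (n : ℕ), -1 < μ.re →
      (∃ C, ∀ t : ℝ, 0 ≤ t → t ^ n * ‖besselF μ t‖ ≤ C) →
      (∃ C, ∀ t : ℝ, 0 ≤ t → t ^ n * ‖besselF (μ + 1) t‖ ≤ C) →
      (∃ C, ∀ t : ℝ, 0 ≤ t → t ^ (n + 1) * ‖besselF (μ + 2) t‖ ≤ C) := by
    rintro μ n hμ ⟨C1, h1⟩ ⟨C2, h2⟩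
    refine ⟨‖μ + 1‖ * C2 + C1, fun t ht => ?_⟩
    have hr := bF_rec μ hμ t
    have e : t * ‖besselF (μ + 2) t‖ = ‖(μ + 1) * besselF (μ + 1) t - besselF μ t‖ := by
      have : (μ + 1) * besselF (μ + 1) t - besselF μ t = t * besselF (μ + 2) t := by
        rw [hr]; ring
      rw [this, norm_mul, Complex.norm_real, Real.norm_of_nonneg ht]
    have e2 : t * ‖besselF (μ + 2) t‖ ≤ ‖μ + 1‖ * ‖besselF (μ + 1) t‖ + ‖besselF μ t‖ := by
      rw [e, ← norm_mul]; exact norm_sub_le _ _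
    calc t ^ (n + 1) * ‖besselF (μ + 2) t‖ = t ^ n * (t * ‖besselF (μ + 2) t‖) := by ring
      _ ≤ t ^ n * (‖μ + 1‖ * ‖besselF (μ + 1) t‖ + ‖besselF μ t‖) := by gcongr
      _ = ‖μ + 1‖ * (t ^ n * ‖besselF (μ + 1) t‖) + t ^ n * ‖besselF μ t‖ := by ring
      _ ≤ _ := by gcongr; exacts [h2 t ht, h1 t ht]
  induction n with
  | zero =>
    have := bF_bounded ν hν
    have := bF_bounded (ν + 1) (by simp; linarith)
    simpa using ⟨‹_›, ‹_›⟩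
  | succ n ih =>
    obtain ⟨i1, i2⟩ := ih
    have p : (0:ℝ) ≤ n := Nat.cast_nonneg n
    have h1 := step (ν + (2 * n : ℕ)) n (by simp; linarith) i1 (by
      convert i2 using 6; push_cast; ring_nf)
    have h1' : ∃ C, ∀ t : ℝ, 0 ≤ t → t ^ (n + 1) * ‖besselF (ν + (2 * (n + 1) : ℕ)) t‖ ≤ C := by
      convert h1 using 6; push_cast; ring_nf
    refine ⟨h1', ?_⟩
    have i3 : ∃ C, ∀ t : ℝ, 0 ≤ t → t ^ n * ‖besselF (ν + (2 * n + 1 : ℕ) + 1) t‖ ≤ C := by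
      have hb := bF_bounded (ν + (2 * n + 1 : ℕ) + 1) (by simp; linarith)
      obtain ⟨C1, hC1⟩ := hb
      obtain ⟨C2, hC2⟩ := h1
      refine ⟨C1 + C2, fun t ht => ?_⟩
      have e : ν + (2 * n + 1 : ℕ) + 1 = ν + (2 * n : ℕ) + 2 := by push_cast; ring
      have hC1 := hC1 t ht
      have hC2 := hC2 t ht
      rw [← e] at hC2
      set x := ‖besselF (ν + (2 * n + 1 : ℕ) + 1) t‖
      have hx : 0 ≤ x := norm_nonneg _
      rcases le_total t 1 with h | h
      · have : t ^ n ≤ 1 := pow_le_one₀ ht h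
        have : 0 ≤ t ^ (n + 1) * x := by positivity
        nlinarith
      · have : t ^ n ≤ t ^ (n + 1) := pow_le_pow_right₀ h (by omega)
        nlinarith
    have h2 := step (ν + (2 * n + 1 : ℕ)) n (by simp; linarith) i2 i3
    convert h2 using 6; push_cast; ring_nf

lemma cpow_contDiffOn (c : ℂ) : ContDiffOn ℝ (⊤ : ℕ∞) (fun s : ℝ => (s : ℂ) ^ c) (Ioi 0) := by
  have h : ContDiffOn ℝ (⊤ : ℕ∞) (fun s : ℝ => Complex.exp ((Real.log s : ℂ) * c)) (Ioi 0) := by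
    have h1 : ContDiffOn ℝ (⊤ : ℕ∞) Real.log (Ioi 0) :=
      Real.contDiffOn_log.mono fun x hx => (ne_of_gt hx)
    have h2 : ContDiffOn ℝ (⊤ : ℕ∞) (fun s : ℝ => (Real.log s : ℂ)) (Ioi 0) :=
      Complex.ofRealCLM.contDiff.comp_contDiffOn h1
    exact (h2.mul contDiffOn_const).cexp
  refine h.congr fun s hs => ?_
  have hs : (0:ℝ) < s := hs
  rw [Complex.cpow_def_of_ne_zero (by exact_mod_cast hs.ne'), Complex.ofReal_log hs.le]

lemma cpow_hasDerivAt (c : ℂ) (s : ℝ) (hs : 0 < s) :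
    HasDerivAt (fun s : ℝ => (s : ℂ) ^ c) (c * (s : ℂ) ^ (c - 1)) s := by
  have := ((hasDerivAt_id (s : ℂ)).cpow_const (c := c) (by simp [Complex.mem_slitPlane_iff, hs])).comp_ofReal
  simpa using this

def GoodFn (M δ : ℝ) (g : ℝ → ℂ) : Prop :=
  ContDiffOn ℝ (⊤ : ℕ∞) g (Ioi 0) ∧ (∀ s > M, g s = 0) ∧
    ∃ c α : ℂ, ∀ s ∈ Ioo (0:ℝ) δ, g s = c * ((1 - s ^ 2 : ℝ) : ℂ) ^ α

noncomputable def dOp (g : ℝ → ℂ) : ℝ → ℂ := fun s => deriv g s / (s : ℂ)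

lemma GoodFn.dOp {M δ : ℝ} {g : ℝ → ℂ} (hδ1 : δ ≤ 1)
    (h : GoodFn M δ g) : GoodFn M δ (dOp g) := by
  obtain ⟨h1, h2, c, α, h3⟩ := h
  refine ⟨?_, ?_, c * (-2 * α), α - 1, ?_⟩
  · have := ((contDiffOn_infty_iff_deriv_of_isOpen isOpen_Ioi).mp h1).2
    refine (this.mul (cpow_contDiffOn (-1))).congr fun s hs => ?_
    rw [Complex.cpow_neg_one]; rfl
  · intro s hs
    have : g =ᶠ[nhds s] fun _ => 0 := by
      filter_upwards [Ioi_mem_nhds hs] with x hx using h2 x hx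
    unfold _root_.dOp
    rw [this.deriv_eq]; simp
  · intro s hs
    have : g =ᶠ[nhds s] fun s => c * ((1 - s ^ 2 : ℝ) : ℂ) ^ α := by
      filter_upwards [Ioo_mem_nhds hs.1 hs.2] with x hx using h3 x hx
    have hp : 0 < 1 - s ^ 2 := by nlinarith [hs.1, hs.2]
    have hd : HasDerivAt (fun s : ℝ => (1 - s ^ 2 : ℝ)) (-(2 * s)) s := by
      simpa using (hasDerivAt_pow 2 s).const_sub 1
    have hd2 := ((cpow_hasDerivAt α _ hp).scomp s hd).const_mul c
    unfold _root_.dOp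
    rw [this.deriv_eq]
    have hd3 : deriv (fun s : ℝ => c * ((1 - s ^ 2 : ℝ) : ℂ) ^ α) s = _ := hd2.deriv
    rw [hd3]
    have hs0 : (s : ℂ) ≠ 0 := by exact_mod_cast hs.1.ne'
    simp only [Complex.real_smul]
    push_cast
    field_simp

lemma GoodFn.bdd {M δ : ℝ} {g : ℝ → ℂ} (hδ : 0 < δ) (hδ1 : δ ≤ 1)
    (h : GoodFn M δ g) : ∃ C, 0 ≤ C ∧ ∀ s > 0, ‖g s‖ ≤ C := by
  obtain ⟨h1, h2, c, α, h3⟩ := h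
  have hc1 : ContinuousOn (fun s : ℝ => c * ((1 - s ^ 2 : ℝ) : ℂ) ^ α) (Icc 0 (δ / 2)) := by
    intro s hs
    have hp : 0 < 1 - s ^ 2 := by nlinarith [hs.1, hs.2]
    have hd : HasDerivAt (fun s : ℝ => (1 - s ^ 2 : ℝ)) (-(2 * s)) s := by
      simpa using (hasDerivAt_pow 2 s).const_sub 1
    exact (((cpow_hasDerivAt α _ hp).scomp s hd).const_mul c).continuousAt.continuousWithinAt
  have hc2 : ContinuousOn g (Icc (δ / 2) M) :=
    h1.continuousOn.mono fun s hs => lt_of_lt_of_le (by positivity) hs.1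
  obtain ⟨C1, hC1⟩ := isCompact_Icc.exists_bound_of_continuousOn hc1
  obtain ⟨C2, hC2⟩ := isCompact_Icc.exists_bound_of_continuousOn hc2
  refine ⟨max 0 (max C1 C2), le_max_left _ _, fun s hs => ?_⟩
  rcases le_total s (δ / 2) with h | h
  · rw [h3 s ⟨hs, by linarith⟩]
    exact (hC1 s ⟨hs.le, h⟩).trans (by simp)
  · rcases le_or_gt s M with h' | h'
    · exact (hC2 s ⟨h, h'⟩).trans (by simp)
    · rw [h2 s h']; simp

lemma GoodFn.integrable {M δ : ℝ} {g : ℝ → ℂ} (hM : 0 < M) (hδ : 0 < δ) (hδ1 : δ ≤ 1)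
    (h : GoodFn M δ g) (β : ℂ) (hβ : -1 < β.re) (G : ℝ → ℂ) (hG : Continuous G) :
    IntegrableOn (fun s : ℝ => g s * ((s : ℂ) ^ β * G s)) (Ioi 0) := by
  obtain ⟨C, hC0, hC⟩ := h.bdd hδ hδ1
  obtain ⟨C2, hC2⟩ := (isCompact_Icc (a := 0) (b := M)).exists_bound_of_continuousOn hG.continuousOn
  rw [← Ioc_union_Ioi_eq_Ioi hM.le]
  refine IntegrableOn.union ?_ ?_
  · have hi := ((intervalIntegral.intervalIntegrable_cpow' (a := 0) (b := M) hβ).1)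
    have hb : IntegrableOn (fun s : ℝ => (g s * G s) * (s : ℂ) ^ β) (Ioc 0 M) := by
      refine Integrable.bdd_mul (c := C * C2) hi ?_ ?_
      · refine ContinuousOn.aestronglyMeasurable ?_ measurableSet_Ioc
        exact (h.1.continuousOn.mono fun s hs => hs.1).mul hG.continuousOn
      · refine (ae_restrict_iff' measurableSet_Ioc).mpr (Eventually.of_forall fun s hs => ?_)
        rw [norm_mul]
        have := hC s hs.1
        have := hC2 s ⟨hs.1.le, hs.2⟩
        gcongr
    refine hb.congr (Eventually.of_forall fun s => ?_)
    simp only; ring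
  · refine (integrableOn_zero (ε' := ℂ)).congr_fun (fun s hs => ?_) measurableSet_Ioi
    rw [h.2.1 s hs]; simp

lemma bF_continuous (ν : ℂ) (hν : -1 < ν.re) : Continuous (besselF ν) :=
  continuous_iff_continuousAt.mpr fun t => (bF_hasDerivAt ν hν t).continuousAt

lemma hankel_step {M δ : ℝ} {g : ℝ → ℂ} (hM : 0 < M) (hδ : 0 < δ) (hδ1 : δ ≤ 1)
    (h : GoodFn M δ g) (ν : ℂ) (hν : -1 < ν.re) (a : ℝ) :
    ∫ s in Ioi (0:ℝ), g s * ((s : ℂ) ^ (2 * ν + 1) * besselF ν (a * s ^ 2)) =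
      (-1 / 2) * ∫ s in Ioi (0:ℝ), dOp g s *
        ((s : ℂ) ^ (2 * (ν + 1) + 1) * besselF (ν + 1) (a * s ^ 2)) := by
  have hν1 : -1 < (ν + 1).re := by simp; linarith
  have hcF : ∀ μ : ℂ, -1 < μ.re → Continuous fun s : ℝ => besselF μ (a * s ^ 2) := fun μ hμ =>
    (bF_continuous μ hμ).comp (by fun_prop)
  obtain ⟨C, hC0, hC⟩ := h.bdd hδ hδ1
  have hu : ∀ x ∈ Ioi (0:ℝ), HasDerivAt g (deriv g x) x := fun x hx =>
    ((h.1.differentiableOn (by simp)).differentiableAt (Ioi_mem_nhds hx)).hasDerivAt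
  have hv : ∀ x ∈ Ioi (0:ℝ), HasDerivAt
      (fun s : ℝ => (s : ℂ) ^ (2 * ν + 2) * besselF (ν + 1) (a * s ^ 2))
      (2 * ((x : ℂ) ^ (2 * ν + 1) * besselF ν (a * x ^ 2))) x := by
    intro x hx
    have hx0 : (x : ℂ) ≠ 0 := by exact_mod_cast (ne_of_gt hx)
    have d1 := cpow_hasDerivAt (2 * ν + 2) x hx
    have d2 : HasDerivAt (fun s : ℝ => a * s ^ 2) (a * (2 * x)) x := by
      simpa using (hasDerivAt_pow 2 x).const_mul a
    have d3 := (bF_hasDerivAt (ν + 1) hν1 (a * x ^ 2)).scomp x d2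
    refine HasDerivAt.congr_deriv (d1.mul d3) ?_
    have e1 : 2 * ν + 2 - 1 = 2 * ν + 1 := by ring
    have e2 : (x : ℂ) ^ (2 * ν + 2) = (x : ℂ) ^ (2 * ν + 1) * x := by
      have : 2 * ν + 2 = (2 * ν + 1) + 1 := by ring
      rw [this, Complex.cpow_add _ _ hx0, Complex.cpow_one]
    have e3 : ν + 1 + 1 = ν + 2 := by ring
    rw [e1, e2, e3, bF_rec ν hν]
    simp only [Complex.real_smul, Function.comp]
    push_cast
    ring
  have e4 : ∀ x ∈ Ioi (0:ℝ), deriv g x * ((x : ℂ) ^ (2 * ν + 2) * besselF (ν + 1) (a * x ^ 2)) =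
      dOp g x * ((x : ℂ) ^ (2 * (ν + 1) + 1) * besselF (ν + 1) (a * x ^ 2)) := by
    intro x hx
    have hx0 : (x : ℂ) ≠ 0 := by exact_mod_cast (ne_of_gt hx)
    have : 2 * (ν + 1) + 1 = (2 * ν + 2) + 1 := by ring
    rw [this, Complex.cpow_add (2 * ν + 2) 1 hx0, Complex.cpow_one, dOp]
    field_simp
  have I1 := h.integrable hM hδ hδ1 (2 * ν + 1) (by simp; linarith) _ (hcF ν hν)
  have I2 := (h.dOp hδ1).integrable hM hδ hδ1 (2 * (ν + 1) + 1) (by simp; linarith) _ (hcF _ hν1)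
  have key := integral_Ioi_mul_deriv_eq_deriv_mul (a := 0) (a' := (0:ℂ)) (b' := (0:ℂ)) hu hv
    (by
      refine (I1.const_mul 2).congr (Eventually.of_forall fun s => ?_)
      simp only [Pi.mul_apply]; ring)
    (by
      refine I2.congr_fun (fun s hs => ?_) measurableSet_Ioi
      exact (e4 s hs).symm)
    (by
      have hFt : Tendsto (fun s : ℝ => C * (s ^ (2 * ν.re + 2) * ‖besselF (ν + 1) (a * s ^ 2)‖))
          (nhdsWithin 0 (Ioi 0)) (nhds (C * (0 ^ (2 * ν.re + 2) * ‖besselF (ν + 1) (a * 0 ^ 2)‖))) := by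
        refine Tendsto.mono_left ?_ nhdsWithin_le_nhds
        refine Tendsto.const_mul _ (Tendsto.mul ?_ ?_)
        · exact (Real.continuousAt_rpow_const _ _ (Or.inr (by linarith))).tendsto
        · exact ((hcF _ hν1).norm).tendsto 0
      rw [Real.zero_rpow (by linarith)] at hFt
      simp only [zero_mul, mul_zero] at hFt
      refine squeeze_zero_norm' ?_ hFt
      filter_upwards [self_mem_nhdsWithin] with s hs
      have hs : 0 < s := hs
      simp only [Pi.mul_apply, norm_mul]
      rw [Complex.norm_cpow_eq_rpow_re_of_pos hs]
      have := hC s hs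
      have e : (2 * ν + 2).re = 2 * ν.re + 2 := by simp
      rw [e]
      gcongr)
    (by
      refine tendsto_const_nhds.congr' ?_
      filter_upwards [eventually_gt_atTop M] with s hs
      simp [h.2.1 s hs])
  rw [setIntegral_congr_fun measurableSet_Ioi e4] at key
  have e5 : ∀ x : ℝ, g x * (2 * ((x : ℂ) ^ (2 * ν + 1) * besselF ν (a * x ^ 2))) =
    2 * (g x * ((x : ℂ) ^ (2 * ν + 1) * besselF ν (a * x ^ 2))) := fun x => by ring
  simp only [e5] at key
  rw [integral_const_mul] at key
  linear_combination (1 / 2) * key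

lemma GoodFn.iter {M δ : ℝ} {g : ℝ → ℂ} (hδ1 : δ ≤ 1)
    (h : GoodFn M δ g) (N : ℕ) : GoodFn M δ (_root_.dOp^[N] g) := by
  induction N with
  | zero => exact h
  | succ N ih => rw [Function.iterate_succ_apply']; exact ih.dOp hδ1

lemma hankel_iter {M δ : ℝ} {g : ℝ → ℂ} (hM : 0 < M) (hδ : 0 < δ) (hδ1 : δ ≤ 1)
    (h : GoodFn M δ g) (ν : ℂ) (hν : -1 < ν.re) (a : ℝ) (N : ℕ) :
    ∫ s in Ioi (0:ℝ), g s * ((s : ℂ) ^ (2 * ν + 1) * besselF ν (a * s ^ 2)) =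
      (-1 / 2) ^ N * ∫ s in Ioi (0:ℝ), dOp^[N] g s *
        ((s : ℂ) ^ (2 * (ν + N) + 1) * besselF (ν + N) (a * s ^ 2)) := by
  induction N with
  | zero => simp
  | succ N ih =>
    have p : (0:ℝ) ≤ N := Nat.cast_nonneg N
    rw [ih, hankel_step hM hδ hδ1 (h.iter hδ1 N) (ν + N) (by simp; linarith) a,
      Function.iterate_succ_apply', pow_succ, mul_assoc]
    push_cast
    rw [add_assoc ν]

lemma hankel_bound {M δ : ℝ} {g : ℝ → ℂ} (hM : 0 < M) (hδ : 0 < δ) (hδ1 : δ ≤ 1)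
    (h : GoodFn M δ g) (ν : ℂ) (hν : -1 < ν.re) (n : ℕ) :
    ∃ K, ∀ a : ℝ, 0 < a →
      ‖∫ s in Ioi (0:ℝ), g s * ((s : ℂ) ^ (2 * ν + 1) * besselF ν (a * s ^ 2))‖ ≤ K * (a ^ n)⁻¹ := by
  obtain ⟨C, hC⟩ := (bF_decay (ν + 1) (by simp; linarith) n).1
  have hg := h.iter hδ1 (2 * n + 1)
  have p : (0:ℝ) ≤ n := Nat.cast_nonneg n
  have I := (hg.integrable hM hδ hδ1 (2 * ν + 2 * n + 3) (by simp; linarith) (fun _ => 1)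
    continuous_const).norm
  refine ⟨‖((-1 / 2) ^ (2 * n + 1) : ℂ)‖ * (C * ∫ s in Ioi (0:ℝ),
    ‖dOp^[2 * n + 1] g s * ((s : ℂ) ^ (2 * ν + 2 * n + 3) * 1)‖), fun a ha => ?_⟩
  rw [hankel_iter hM hδ hδ1 h ν hν a (2 * n + 1), norm_mul, mul_assoc]
  gcongr
  rw [mul_right_comm, ← integral_const_mul]
  refine norm_integral_le_of_norm_le (I.const_mul _) ?_
  refine (ae_restrict_iff' measurableSet_Ioi).mpr (Eventually.of_forall fun s hs => ?_)
  have hs : 0 < s := hs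
  have hs0 : (s : ℂ) ≠ 0 := by exact_mod_cast hs.ne'
  have e1 : (s : ℂ) ^ (2 * (ν + (2 * n + 1 : ℕ)) + 1) = (s : ℂ) ^ (2 * ν + 2 * n + 3) * ((s ^ 2) ^ n : ℝ) := by
    have : 2 * (ν + (2 * n + 1 : ℕ)) + 1 = (2 * ν + 2 * n + 3) + (2 * n : ℕ) := by push_cast; ring
    rw [this, Complex.cpow_add _ _ hs0, Complex.cpow_natCast, pow_mul]; push_cast; rfl
  have e2 : ν + (2 * n + 1 : ℕ) = ν + 1 + (2 * n : ℕ) := by push_cast; ring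
  have hb := hC (a * s ^ 2) (by positivity)
  rw [e1, e2]
  simp only [norm_mul, norm_one, mul_one, Complex.norm_real]
  rw [Real.norm_of_nonneg (by positivity : 0 ≤ (s ^ 2) ^ n)]
  rw [mul_pow] at hb
  have hb2 : (s ^ 2) ^ n * ‖besselF (ν + 1 + (2 * n : ℕ)) (a * s ^ 2)‖ ≤ C * (a ^ n)⁻¹ := by
    rw [← div_eq_mul_inv, le_div_iff₀ (by positivity)]
    linarith
  calc _ = ‖dOp^[2 * n + 1] g s‖ * ‖(s : ℂ) ^ (2 * ν + 2 * n + 3)‖ *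
        ((s ^ 2) ^ n * ‖besselF (ν + 1 + (2 * n : ℕ)) (a * s ^ 2)‖) := by ring
    _ ≤ ‖dOp^[2 * n + 1] g s‖ * ‖(s : ℂ) ^ (2 * ν + 2 * n + 3)‖ * (C * (a ^ n)⁻¹) := by gcongr
    _ = _ := by ring

lemma besselJ_eq (ν : ℂ) (r s : ℝ) (hr : 0 < r) (hs : 0 < s) :
    besselJ ν (r * s) = ((r / 2 : ℝ) : ℂ) ^ ν * ((s : ℂ) ^ ν * besselF ν (r ^ 2 / 4 * s ^ 2)) := by
  unfold besselJ besselF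
  rw [← mul_assoc, ← tsum_mul_left]
  refine tsum_congr fun k => ?_
  have e : (((r * s : ℝ) : ℂ) / 2) = ((r / 2 : ℝ) : ℂ) * (s : ℂ) := by push_cast; ring
  have hne : ((r / 2 : ℝ) : ℂ) * (s : ℂ) ≠ 0 := by
    have : r / 2 * s ≠ 0 := by positivity
    exact_mod_cast this
  have e2 : (2 * (k : ℂ)) = (2 * k : ℕ) := by push_cast; rfl
  rw [e, Complex.cpow_add _ _ hne, Complex.mul_cpow_ofReal_nonneg (by positivity) hs.le ν, e2,
    Complex.cpow_natCast, pow_mul]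
  have e3 : (((r / 2 : ℝ) : ℂ) * (s : ℂ)) ^ 2 = ((r ^ 2 / 4 * s ^ 2 : ℝ) : ℂ) := by
    push_cast; ring
  rw [e3]
  unfold besselCoeff
  ring

/-- Let `Re ν > -1`, `α ∈ ℂ`, and let `φ` be smooth on `(0,∞)` with bounded support and
`φ(s) = s^{ν+1} (1-s²)^α` near `s = 0`.  Then `∫₀^∞ φ(s) J_ν(rs) ds = o(r^{-A})` as
`r → ∞` for every real `A`. -/
theorem hankel_rapid_decay_of_model_at_origin (ν α : ℂ) (hν : -1 < ν.re)
    (φ : ℝ → ℂ) (hφ : ContDiffOn ℝ (⊤ : ℕ∞) φ (Set.Ioi 0))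
    (hbdd : ∃ M : ℝ, ∀ s : ℝ, M ≤ s → φ s = 0)
    (δ : ℝ) (hδ : 0 < δ)
    (hmodel : ∀ s ∈ Set.Ioo (0:ℝ) δ,
      φ s = (s : ℂ) ^ (ν + 1) * ((1 - s ^ 2 : ℝ) : ℂ) ^ α) :
    ∀ A : ℝ,
      (fun r : ℝ => ∫ s in Set.Ioi (0:ℝ), φ s * besselJ ν (r * s))
        =o[atTop] fun r : ℝ => r ^ (-A) := by
  intro A
  obtain ⟨M, hM⟩ := hbdd
  set M' : ℝ := max M 1 with hM'
  set δ' : ℝ := min δ 1 with hδ'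
  have hMp : 0 < M' := lt_of_lt_of_le one_pos (le_max_right _ _)
  have hδp : 0 < δ' := lt_min hδ one_pos
  have hδ1 : δ' ≤ 1 := min_le_right _ _
  set g : ℝ → ℂ := fun s => φ s * (s : ℂ) ^ (-(ν + 1)) with hgdef
  have hg : GoodFn M' δ' g := by
    refine ⟨hφ.mul (cpow_contDiffOn _), fun s hs => ?_, 1, α, fun s hs => ?_⟩
    · simp [hgdef, hM s ((le_max_left M 1).trans (le_of_lt hs))]
    · have hs0 : (s : ℂ) ≠ 0 := by exact_mod_cast hs.1.ne'
      have hne : (s : ℂ) ^ (ν + 1) ≠ 0 := by simp [Complex.cpow_eq_zero_iff, hs0]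
      simp only [hgdef]
      rw [hmodel s ⟨hs.1, hs.2.trans_le (min_le_left _ _)⟩, Complex.cpow_neg]
      field_simp
  obtain ⟨n, hn⟩ := exists_nat_gt ((ν.re + A) / 2)
  obtain ⟨K, hK⟩ := hankel_bound hMp hδp hδ1 hg ν hν n
  have heq : ∀ r : ℝ, 0 < r → ∫ s in Set.Ioi (0:ℝ), φ s * besselJ ν (r * s) =
      ((r / 2 : ℝ) : ℂ) ^ ν *
        ∫ s in Ioi (0:ℝ), g s * ((s : ℂ) ^ (2 * ν + 1) * besselF ν (r ^ 2 / 4 * s ^ 2)) := by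
    intro r hr
    rw [← integral_const_mul]
    refine setIntegral_congr_fun measurableSet_Ioi fun s hs => ?_
    have hs : 0 < s := hs
    have hs0 : (s : ℂ) ≠ 0 := by exact_mod_cast hs.ne'
    have e : (s : ℂ) ^ (-(ν + 1)) * (s : ℂ) ^ (2 * ν + 1) = (s : ℂ) ^ ν := by
      rw [← Complex.cpow_add _ _ hs0]; congr 1; ring
    simp only [hgdef]
    rw [besselJ_eq ν r s hr hs, ← e]
    ring
  have hO : (fun r : ℝ => ∫ s in Set.Ioi (0:ℝ), φ s * besselJ ν (r * s))
      =O[atTop] fun r : ℝ => r ^ (ν.re - 2 * n) := by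
    refine Asymptotics.IsBigO.of_bound ((1 / 2 : ℝ) ^ ν.re * (K * 4 ^ n)) ?_
    filter_upwards [eventually_gt_atTop 0] with r hr
    rw [heq r hr, norm_mul, Complex.norm_cpow_eq_rpow_re_of_pos (by positivity),
      Real.norm_of_nonneg (by positivity)]
    have h1 := hK (r ^ 2 / 4) (by positivity)
    have e1 : (r / 2) ^ ν.re = (1 / 2 : ℝ) ^ ν.re * r ^ ν.re := by
      rw [← Real.mul_rpow (by norm_num) hr.le]; congr 1; ring
    have e2 : r ^ (ν.re - 2 * n) = r ^ ν.re * ((r ^ 2) ^ n)⁻¹ := by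
      rw [Real.rpow_sub hr, div_eq_mul_inv, ← pow_mul, ← Real.rpow_natCast r (2 * n)]
      push_cast; rfl
    rw [e1, e2]
    calc _ ≤ (1 / 2 : ℝ) ^ ν.re * r ^ ν.re * (K * ((r ^ 2 / 4) ^ n)⁻¹) := by gcongr
      _ = _ := by
        rw [div_pow, inv_div, div_eq_mul_inv]; ring
  refine hO.trans_isLittleO ?_
  refine Asymptotics.isLittleO_of_tendsto' ?_ ?_
  · filter_upwards [eventually_gt_atTop 0] with r hr h0
    exact absurd h0 (Real.rpow_pos_of_pos hr _).ne'
  · have ht := tendsto_rpow_neg_atTop (y := 2 * n - ν.re - A) (by linarith)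
    refine ht.congr' ?_
    filter_upwards [eventually_gt_atTop 0] with r hr
    rw [← Real.rpow_sub hr]
    congr 1; ring
end

section
/- Let N be a nonnegative integer, Λ ∈ ℂ with Re Λ ≥ N, and 0 < ε < 1. Let ψ be a smooth function on (0,1) such that ψ(t) = 0 for 0 < t < ε and such that ψ^{(k)} is integrable on (0,1) for 0 ≤ k ≤ N. Set φ(t) = (1 − t)^Λ ψ(t). Then for any real ν with ν ≥ −N, ∫₀¹ s^{ν+1} φ(s²) J_ν(rs) ds = o(r^{−(N+1/2)}) as r → ∞. -/
open MeasureTheory Filter Set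

open Topology

/-- Coefficients of the Bessel power series. -/
noncomputable def bco (μ : ℝ) (k : ℕ) : ℝ :=
  (-1) ^ k / ((Nat.factorial k : ℝ) * Real.Gamma (μ + k + 1))

/-- The entire part of the Bessel function. -/
noncomputable def bF (μ : ℝ) (y : ℝ) : ℝ := ∑' k : ℕ, bco μ k * y ^ k

lemma inv_Gamma_rec (s : ℝ) : (Real.Gamma s)⁻¹ = s * (Real.Gamma (s + 1))⁻¹ := by
  rcases eq_or_ne s 0 with h | h
  · simp [h]
  · rw [Real.Gamma_add_one h]
    by_cases hg : Real.Gamma s = 0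
    · simp [hg]
    · field_simp

lemma bco_succ (μ : ℝ) (k : ℕ) : bco μ (k + 1) * ((k : ℝ) + 1) = - bco (μ + 1) k := by
  unfold bco
  rw [Nat.factorial_succ]
  have e : μ + ((k + 1 : ℕ) : ℝ) + 1 = μ + 1 + k + 1 := by push_cast; ring
  rw [e]
  have h1 : ((k : ℝ) + 1) ≠ 0 := by positivity
  rw [pow_succ]
  push_cast
  simp only [div_eq_mul_inv, mul_inv]
  field_simp

lemma bco_rec (μ : ℝ) (k : ℕ) : (μ + 1 + k) * bco (μ + 1) k = bco μ k := by
  unfold bco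
  have h := inv_Gamma_rec (μ + k + 1)
  have e : μ + 1 + (k : ℝ) + 1 = μ + k + 1 + 1 := by ring
  rw [e]
  simp only [div_eq_mul_inv, mul_inv]
  rw [h]; ring

lemma bco_summable (μ y : ℝ) : Summable fun k : ℕ => bco μ k * y ^ k := by
  rcases eq_or_ne y 0 with hy | hy
  · subst hy
    apply summable_of_ne_finset_zero (s := {0})
    intro b hb
    have : b ≠ 0 := by simpa using hb
    simp [this]
  have hev : ∀ᶠ k : ℕ in atTop, 1 ≤ μ + k := by
    have : Tendsto (fun k : ℕ => μ + (k : ℝ)) atTop atTop :=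
      tendsto_atTop_add_const_left _ _ tendsto_natCast_atTop_atTop
    exact this.eventually_ge_atTop 1
  have hpos : ∀ᶠ k : ℕ in atTop, bco μ k ≠ 0 := by
    filter_upwards [hev] with k hk
    have : 0 < Real.Gamma (μ + k + 1) := Real.Gamma_pos_of_pos (by linarith)
    unfold bco
    positivity
  apply summable_of_ratio_test_tendsto_lt_one (l := 0) zero_lt_one
  · filter_upwards [hpos] with k hk
    positivity
  · have h1 : Tendsto (fun k : ℕ => |y| * ((k : ℝ) + 1)⁻¹) atTop (𝓝 0) := by
      have : Tendsto (fun k : ℕ => ((k : ℝ) + 1)⁻¹) atTop (𝓝 0) :=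
        tendsto_inv_atTop_zero.comp
          (tendsto_atTop_add_const_right _ _ tendsto_natCast_atTop_atTop)
      simpa using this.const_mul |y|
    refine squeeze_zero' (Eventually.of_forall fun k => by positivity) ?_ h1
    filter_upwards [hev, hpos] with k hk hk2
    have h2 := bco_succ μ k
    have h3 := bco_rec μ k
    have h4 : |bco μ (k + 1)| * ((k : ℝ) + 1) = |bco (μ + 1) k| := by
      rw [← abs_neg (bco (μ + 1) k), ← h2, abs_mul, abs_of_nonneg (by positivity : (0:ℝ) ≤ k + 1)]
    have h5 : |bco (μ + 1) k| ≤ |bco μ k| := by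
      rw [← h3, abs_mul]
      apply le_mul_of_one_le_left (abs_nonneg _)
      exact le_trans (by linarith) (le_abs_self _)
    have hk3 : 0 < |bco μ k| := abs_pos.mpr hk2
    rw [Real.norm_eq_abs, Real.norm_eq_abs, abs_mul, abs_mul, abs_pow, abs_pow, pow_succ]
    have hy' : 0 < |y| := abs_pos.mpr hy
    rw [div_le_iff₀ (by positivity)]
    have : |y| * ((k : ℝ) + 1)⁻¹ * (|bco μ k| * |y| ^ k)
      = (((k : ℝ) + 1)⁻¹ * |bco μ k|) * (|y| ^ k * |y|) := by ring
    rw [this]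
    gcongr
    rw [inv_mul_eq_div, le_div_iff₀ (by positivity), h4]
    exact h5

lemma bF_hasDerivAt_s12 (μ y : ℝ) : HasDerivAt (bF μ) (- bF (μ + 1) y) y := by
  set R := |y| + 1 with hR
  have hRp : 0 < R := by positivity
  have key := hasDerivAt_tsum_of_isPreconnected (𝕜 := ℝ)
    (u := fun k : ℕ => |bco μ k * (k * R ^ (k - 1))|)
    (g := fun k z => bco μ k * z ^ k) (g' := fun k z => bco μ k * (k * z ^ (k - 1)))
    (t := Metric.ball (0:ℝ) R) (y₀ := 0) (y := y) ?_ Metric.isOpen_ball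
    (convex_ball (0:ℝ) R).isPreconnected ?_ ?_ ?_ ?_ ?_
  · have e : (∑' k : ℕ, bco μ k * (k * y ^ (k - 1))) = - bF (μ + 1) y := by
      unfold bF
      rw [tsum_eq_zero_add', ← tsum_neg]
      · simp only [Nat.cast_zero, zero_mul, mul_zero, zero_add]
        congr 1; ext k
        have := bco_succ μ k
        push_cast
        rw [← mul_assoc, this]; simp
      · refine (bco_summable (μ + 1) y).neg.congr fun k => ?_
        have := bco_succ μ k
        push_cast
        rw [← mul_assoc, this]; simp
    rw [e] at key
    exact key
  · rw [← summable_nat_add_iff 1]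
    refine (bco_summable (μ + 1) R).abs.congr fun k => ?_
    have := bco_succ μ k
    push_cast
    rw [← mul_assoc, this]; simp
  · intro n z _
    exact (hasDerivAt_pow n z).const_mul _
  · intro n z hz
    have hz' : |z| ≤ R := by
      have := Metric.mem_ball.mp hz
      rw [dist_zero_right, Real.norm_eq_abs] at this; exact this.le
    rw [Real.norm_eq_abs, abs_mul, abs_mul, abs_mul, abs_mul, abs_pow, abs_pow, abs_of_pos hRp]
    gcongr
  · simp [hRp]
  · exact bco_summable μ 0
  · simp [hR]

lemma bF_rec_s12 (μ y : ℝ) : bF μ y = (μ + 1) * bF (μ + 1) y - y * bF (μ + 2) y := by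
  have h1 : HasSum (fun k : ℕ => (k : ℝ) * bco (μ + 1) k * y ^ k) (- (y * bF (μ + 2) y)) := by
    rw [← hasSum_nat_add_iff' 1]
    have := ((bco_summable (μ + 2) y).hasSum.mul_left y).neg
    simp only [Finset.range_one, Finset.sum_singleton, Nat.cast_zero, zero_mul, sub_zero]
    convert! this using 1
    ext k
    have h := bco_succ (μ + 1) k
    rw [show μ + 1 + 1 = μ + 2 by ring] at h
    rw [pow_succ]; push_cast
    linear_combination (y ^ k * y) * h
  have h2 := ((bco_summable (μ + 1) y).hasSum.mul_left (μ + 1)).add h1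
  have h3 : HasSum (fun k : ℕ => bco μ k * y ^ k) (bF μ y) := (bco_summable μ y).hasSum
  have h4 : (fun k : ℕ => bco μ k * y ^ k) =
      fun k : ℕ => (μ + 1) * (bco (μ + 1) k * y ^ k) + (k : ℝ) * bco (μ + 1) k * y ^ k := by
    ext k
    rw [← bco_rec]; ring
  rw [h4] at h3
  have := h3.unique h2
  rw [this]; unfold bF; ring

lemma bF_cont (μ : ℝ) : Continuous (bF μ) :=
  continuous_iff_continuousAt.mpr fun y => (bF_hasDerivAt_s12 μ y).continuousAt

lemma besselJ_eq_s12 (ν x : ℝ) (hx : 0 < x) :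
    besselJ (ν : ℂ) x = (((x / 2) ^ ν * bF ν (x ^ 2 / 4) : ℝ) : ℂ) := by
  unfold besselJ bF
  rw [← tsum_mul_left, Complex.ofReal_tsum]
  congr 1; ext k
  have hx2 : 0 < x / 2 := by positivity
  have e1 : ((x : ℂ) / 2) ^ (2 * (k : ℂ) + ν) = (((x / 2) ^ ν * (x ^ 2 / 4) ^ k : ℝ) : ℂ) := by
    have : ((x : ℂ) / 2) = ((x / 2 : ℝ) : ℂ) := by push_cast; ring
    rw [this, show (2 * (k : ℂ) + ν) = ((2 * k + ν : ℝ) : ℂ) by push_cast; ring,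
      ← Complex.ofReal_cpow hx2.le]
    congr 1
    rw [Real.rpow_add hx2, mul_comm]
    congr 1
    rw [show (2 * (k : ℝ)) = ((2 * k : ℕ) : ℝ) by push_cast; ring, Real.rpow_natCast, pow_mul]
    congr 1; ring
  have e2 : Complex.Gamma ((ν : ℂ) + k + 1) = ((Real.Gamma (ν + k + 1) : ℝ) : ℂ) := by
    rw [← Complex.Gamma_ofReal]; push_cast; rfl
  rw [e1, e2]
  unfold bco
  push_cast
  ring

/-- derivative of `y ↦ t^{μ+1} F_{μ+1}(ρ t)`. -/
lemma bK_hasDerivAt (μ ρ t : ℝ) (ht : 0 < t) :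
    HasDerivAt (fun t : ℝ => t ^ (μ + 1) * bF (μ + 1) (ρ * t)) (t ^ μ * bF μ (ρ * t)) t := by
  have h1 : HasDerivAt (fun t : ℝ => t ^ (μ + 1)) ((μ + 1) * t ^ μ) t := by
    simpa using Real.hasDerivAt_rpow_const (x := t) (p := μ + 1) (Or.inl ht.ne')
  have h2 : HasDerivAt (fun t : ℝ => ρ * t) ρ t := by
    simpa using (hasDerivAt_id t).const_mul ρ
  have h3 := h1.mul ((bF_hasDerivAt_s12 (μ + 1) (ρ * t)).comp t h2)
  convert! h3 using 1
  have hr := bF_rec_s12 μ (ρ * t)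
  simp only [Function.comp]
  rw [Real.rpow_add ht, Real.rpow_one, hr, show μ + 1 + 1 = μ + 2 by ring]
  ring

/-- Energy estimate. -/
lemma bF_bound (μ : ℝ) : ∃ C y₀ : ℝ, 0 < C ∧ 0 < y₀ ∧ ∀ y, y₀ ≤ y →
    |bF μ y| ≤ C * y ^ (-(μ / 2 + 1 / 4)) := by
  set m := 2 * μ + 1 with hm
  set y₀ : ℝ := 1 + m ^ 2 with hy₀
  have hy₀p : 0 < y₀ := by positivity
  set Q : ℝ → ℝ := fun y => 2 * bF μ y ^ 2 + 2 * y * bF (μ + 1) y ^ 2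
    - m * (bF μ y * bF (μ + 1) y) with hQ
  set W : ℝ → ℝ := fun y => Real.exp (|m| / 2 * y ^ (-(1/2) : ℝ)) with hW
  set E : ℝ → ℝ := fun y => y ^ (μ + 1 / 2) * Q y * W y with hE
  -- pointwise inequality
  have hsq : ∀ y, y₀ ≤ y → |m| * |bF μ y * bF (μ + 1) y| ≤
      |m| / (2 * Real.sqrt y) * (bF μ y ^ 2 + y * bF (μ + 1) y ^ 2) := by
    intro y hy
    have hyp : 0 < y := lt_of_lt_of_le hy₀p hy
    have hs : 0 < Real.sqrt y := Real.sqrt_pos.mpr hyp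
    have hss : Real.sqrt y ^ 2 = y := Real.sq_sqrt hyp.le
    rw [div_mul_eq_mul_div, le_div_iff₀ (by positivity), mul_assoc]
    gcongr
    rw [abs_mul, ← sq_abs (bF μ y), ← sq_abs (bF (μ + 1) y)]
    generalize |bF μ y| = a at *
    generalize |bF (μ + 1) y| = b at *
    generalize Real.sqrt y = s at *
    rw [← hss]
    nlinarith [sq_nonneg (a - s * b)]
  have hmle : ∀ y, y₀ ≤ y → |m| / (2 * Real.sqrt y) ≤ 1 := by
    intro y hy
    have hyp : 0 < y := lt_of_lt_of_le hy₀p hy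
    rw [div_le_one (by positivity)]
    have : |m| ≤ Real.sqrt y := Real.abs_le_sqrt (by linarith)
    linarith [Real.sqrt_nonneg y]
  have hQge : ∀ y, y₀ ≤ y → bF μ y ^ 2 + y * bF (μ + 1) y ^ 2 ≤ Q y := by
    intro y hy
    have hyp : 0 < y := lt_of_lt_of_le hy₀p hy
    have h1 := hsq y hy
    have h2 := mul_le_mul_of_nonneg_right (hmle y hy)
      (by positivity : 0 ≤ bF μ y ^ 2 + y * bF (μ + 1) y ^ 2)
    rw [← abs_mul] at h1
    have h3 := le_abs_self (m * (bF μ y * bF (μ + 1) y))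
    simp only [hQ]
    linarith
  have hEd : ∀ y, y₀ ≤ y → HasDerivAt E (y ^ (μ + 1 / 2) * W y * (m * (bF μ y * bF (μ + 1) y) / (2 * y)
      - |m| / (4 * (y * Real.sqrt y)) * Q y)) y := by
    intro y hy
    have hyp : 0 < y := lt_of_lt_of_le hy₀p hy
    have hA := bF_hasDerivAt_s12 μ y
    have hB := bF_hasDerivAt_s12 (μ + 1) y
    rw [show μ + 1 + 1 = μ + 2 by ring] at hB
    have hP : HasDerivAt (fun t : ℝ => t ^ (μ + 1 / 2)) ((μ + 1 / 2) * (y ^ (μ + 1 / 2) / y)) y := by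
      have := Real.hasDerivAt_rpow_const (x := y) (p := μ + 1 / 2) (Or.inl hyp.ne')
      rwa [Real.rpow_sub hyp, Real.rpow_one] at this
    have hWd : HasDerivAt W (W y * (- (|m| / (4 * (y * Real.sqrt y))))) y := by
      have h1 := Real.hasDerivAt_rpow_const (x := y) (p := (-(1/2) : ℝ)) (Or.inl hyp.ne')
      have h2 := (h1.const_mul (|m| / 2)).exp
      convert! h2 using 1
      simp only [hW]
      congr 1
      rw [Real.rpow_sub hyp, Real.rpow_one, Real.rpow_neg hyp.le, ← Real.sqrt_eq_rpow]
      field_simp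
      ring
    have hQd := (((hA.pow 2).const_mul 2).add (((hasDerivAt_id y).const_mul 2).mul (hB.pow 2))).sub
      ((hA.mul hB).const_mul m)
    have hEd' := (hP.mul hQd).mul hWd
    convert! hEd' using 1
    have hr := bF_rec_s12 μ y
    have hB2 : bF (μ + 2) y = ((μ + 1) * bF (μ + 1) y - bF μ y) / y := by
      field_simp; linarith
    rw [hB2]
    simp only [hQ, Pi.add_apply, Pi.sub_apply, Pi.mul_apply, Pi.pow_apply, id]
    have hs : Real.sqrt y ≠ 0 := (Real.sqrt_pos.mpr hyp).ne'
    have hmu : μ = (m - 1) / 2 := by rw [hm]; ring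
    generalize y ^ (μ + 1 / 2) = p
    generalize W y = w
    generalize bF μ y = a
    generalize bF (μ + 1) y = b
    rw [hmu]
    clear_value m
    field_simp
    ring
  have hanti : AntitoneOn E (Set.Ici y₀) := by
    apply antitoneOn_of_deriv_nonpos (convex_Ici _)
    · intro y hy; exact (hEd y hy).continuousAt.continuousWithinAt
    · intro y hy
      rw [interior_Ici] at hy
      exact (hEd y hy.le).differentiableAt.differentiableWithinAt
    · intro y hy
      rw [interior_Ici] at hy
      have hy := (Set.mem_Ioi.mp hy).le
      rw [(hEd y hy).deriv]
      have hyp : 0 < y := lt_of_lt_of_le hy₀p hy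
      have hs : 0 < Real.sqrt y := Real.sqrt_pos.mpr hyp
      apply mul_nonpos_of_nonneg_of_nonpos
      · positivity
      · rw [sub_nonpos]
        have h1 := hsq y hy
        rw [← abs_mul] at h1
        have h3 := le_abs_self (m * (bF μ y * bF (μ + 1) y))
        have h4 := hQge y hy
        calc m * (bF μ y * bF (μ + 1) y) / (2 * y)
            ≤ (|m| / (2 * Real.sqrt y) * (bF μ y ^ 2 + y * bF (μ + 1) y ^ 2)) / (2 * y) := by
              apply div_le_div_of_nonneg_right _ (by positivity)
              linarith
          _ = |m| / (4 * (y * Real.sqrt y)) * (bF μ y ^ 2 + y * bF (μ + 1) y ^ 2) := by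
              field_simp; ring
          _ ≤ _ := by gcongr
  refine ⟨Real.sqrt (E y₀) + 1, y₀, by positivity, hy₀p, fun y hy => ?_⟩
  have hyp : 0 < y := lt_of_lt_of_le hy₀p hy
  have h1 : E y ≤ E y₀ := hanti (Set.mem_Ici.mpr le_rfl) hy hy
  have hW1 : 1 ≤ W y := by
    apply Real.one_le_exp; positivity
  have h2 : y ^ (μ + 1 / 2) * bF μ y ^ 2 ≤ E y := by
    have hq := hQge y hy
    have hq2 : bF μ y ^ 2 ≤ Q y := by
      have : 0 ≤ y * bF (μ + 1) y ^ 2 := by positivity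
      linarith
    have hQ0 : 0 ≤ Q y := le_trans (sq_nonneg _) hq2
    calc y ^ (μ + 1 / 2) * bF μ y ^ 2 ≤ y ^ (μ + 1 / 2) * Q y := by gcongr
      _ ≤ y ^ (μ + 1 / 2) * Q y * W y := le_mul_of_one_le_right (by positivity) hW1
  have h3 : (y ^ (μ / 2 + 1 / 4) * bF μ y) ^ 2 ≤ E y₀ := by
    rw [mul_pow, ← Real.rpow_natCast, ← Real.rpow_mul hyp.le]
    have : (μ / 2 + 1 / 4) * ((2 : ℕ) : ℝ) = μ + 1 / 2 := by push_cast; ring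
    rw [this]; exact h2.trans h1
  have h4 := Real.abs_le_sqrt h3
  have hpp : 0 < y ^ (μ / 2 + 1 / 4) := by positivity
  rw [abs_mul, abs_of_pos hpp] at h4
  rw [Real.rpow_neg hyp.le, ← div_eq_mul_inv, le_div_iff₀ hpp]
  linarith

/-- Uniform kernel bound. -/
lemma bK_bound (μ a : ℝ) (ha : 0 < a) : ∃ M r₀ : ℝ, 0 < M ∧ 0 < r₀ ∧ ∀ r, r₀ ≤ r →
    ∀ t ∈ Set.Icc a 1, |r ^ (μ + 1 / 2) * (t ^ μ * bF μ (r ^ 2 / 4 * t))| ≤ M := by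
  obtain ⟨C, y₀, hC, hy₀, hb⟩ := bF_bound μ
  have hcont : ContinuousOn (fun t : ℝ => t ^ μ * (t / 4) ^ (-(μ / 2 + 1 / 4))) (Set.Icc a 1) := by
    intro t ht
    have : 0 < t := lt_of_lt_of_le ha ht.1
    apply ContinuousAt.continuousWithinAt
    apply ContinuousAt.mul
    · exact Real.continuousAt_rpow_const _ _ (Or.inl this.ne')
    · exact ContinuousAt.rpow_const (by fun_prop) (Or.inl (by positivity))
  obtain ⟨B, hB⟩ := isCompact_Icc.exists_bound_of_continuousOn hcont
  refine ⟨C * |B| + 1, 1 + 4 * y₀ / a, by positivity, by positivity, fun r hr t ht => ?_⟩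
  have htp : 0 < t := lt_of_lt_of_le ha ht.1
  have hr1 : 1 ≤ r := le_trans (by have : 0 ≤ 4 * y₀ / a := by positivity
                                   linarith) hr
  have hrp : 0 < r := by linarith
  have hy : y₀ ≤ r ^ 2 / 4 * t := by
    have h1 : 4 * y₀ / a ≤ r := by linarith
    rw [div_le_iff₀ ha] at h1
    have h2 : r * a ≤ r ^ 2 * t := by
      have := ht.1
      have : r ≤ r ^ 2 := by nlinarith
      gcongr
    linarith
  have h1 := hb _ hy
  have e : r ^ (μ + 1 / 2) * (r ^ 2 / 4 * t) ^ (-(μ / 2 + 1 / 4)) = (t / 4) ^ (-(μ / 2 + 1 / 4)) := by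
    rw [show r ^ 2 / 4 * t = r ^ 2 * (t / 4) by ring, Real.mul_rpow (by positivity) (by positivity),
      ← Real.rpow_natCast, ← Real.rpow_mul hrp.le, ← mul_assoc, ← Real.rpow_add hrp]
    have : μ + 1 / 2 + ((2 : ℕ) : ℝ) * -(μ / 2 + 1 / 4) = 0 := by push_cast; ring
    rw [this, Real.rpow_zero, one_mul]
  have h2 := hB t ht
  rw [Real.norm_eq_abs] at h2
  calc |r ^ (μ + 1 / 2) * (t ^ μ * bF μ (r ^ 2 / 4 * t))|
      = r ^ (μ + 1 / 2) * (t ^ μ * |bF μ (r ^ 2 / 4 * t)|) := by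
        rw [abs_mul, abs_mul, abs_of_pos (by positivity : 0 < r ^ (μ + 1 / 2)),
          abs_of_pos (by positivity : 0 < t ^ μ)]
    _ ≤ r ^ (μ + 1 / 2) * (t ^ μ * (C * (r ^ 2 / 4 * t) ^ (-(μ / 2 + 1 / 4)))) := by gcongr
    _ = C * (t ^ μ * (r ^ (μ + 1 / 2) * (r ^ 2 / 4 * t) ^ (-(μ / 2 + 1 / 4)))) := by ring
    _ = C * (t ^ μ * (t / 4) ^ (-(μ / 2 + 1 / 4))) := by rw [e]
    _ ≤ C * |B| := by
        gcongr
        exact (le_abs_self _).trans (h2.trans (le_abs_self _))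
    _ ≤ _ := by linarith

lemma bK_cont (μ ρ a : ℝ) (ha : 0 < a) :
    ContinuousOn (fun t : ℝ => t ^ μ * bF μ (ρ * t)) (Set.Icc a 1) := by
  intro t ht
  have : 0 < t := lt_of_lt_of_le ha ht.1
  apply ContinuousAt.continuousWithinAt
  apply ContinuousAt.mul
  · exact Real.continuousAt_rpow_const _ _ (Or.inl this.ne')
  · exact ((bF_cont μ).comp (continuous_const.mul continuous_id)).continuousAt

lemma bK_mul_integrable (μ ρ a : ℝ) (ha : 0 < a) (g : ℝ → ℂ)
    (hg : IntegrableOn g (Set.Ioo a 1)) :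
    IntegrableOn (fun t : ℝ => ((t ^ μ * bF μ (ρ * t) : ℝ) : ℂ) * g t) (Set.Ioo a 1) := by
  have hc : ContinuousOn (fun t : ℝ => ((t ^ μ * bF μ (ρ * t) : ℝ) : ℂ)) (Set.Icc a 1) :=
    Complex.continuous_ofReal.comp_continuousOn (bK_cont μ ρ a ha)
  obtain ⟨B, hB⟩ := isCompact_Icc.exists_bound_of_continuousOn hc
  refine Integrable.bdd_mul (c := B) hg ?_ ?_
  · exact (hc.mono Set.Ioo_subset_Icc_self).aestronglyMeasurable measurableSet_Ioo
  · filter_upwards [ae_restrict_mem measurableSet_Ioo] with t ht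
    exact hB t (Set.Ioo_subset_Icc_self ht)

/-- Riemann-Lebesgue type lemma. -/
lemma bK_riemannLebesgue (μ a : ℝ) (ha : 0 < a) (ha1 : a < 1) (g : ℝ → ℂ)
    (hg : IntegrableOn g (Set.Ioo a 1)) :
    Tendsto (fun r : ℝ => ((r ^ (μ + 1 / 2) : ℝ) : ℂ) *
      ∫ t in Set.Ioo a 1, ((t ^ μ * bF μ (r ^ 2 / 4 * t) : ℝ) : ℂ) * g t) atTop (𝓝 0) := by
  obtain ⟨M, r₀, hM, hr₀, hb⟩ := bK_bound μ a ha
  obtain ⟨M', r₁, hM', hr₁, hb'⟩ := bK_bound (μ + 1) a ha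
  rw [Metric.tendsto_atTop']
  intro δ hδ
  obtain ⟨f, -, hf, hfg⟩ := MemLp.exist_eLpNorm_sub_le (μ := volume.restrict (Set.Ioo a 1))
    (p := 1) (by simp) le_rfl (memLp_one_iff_integrable.mpr hg)
    (ε := δ / (4 * M)) (by positivity)
  have hfint : IntegrableOn f (Set.Ioo a 1) :=
    (hf.continuous.continuousOn.integrableOn_Icc (a := a) (b := 1)).mono_set Set.Ioo_subset_Icc_self
  have hgf : Integrable (fun t => g t - f t) (volume.restrict (Set.Ioo a 1)) := hg.sub hfint
  have hη : ∫ t in Set.Ioo a 1, ‖g t - f t‖ ≤ δ / (4 * M) := by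
    have h1 := integral_norm_eq_lintegral_enorm hgf.aestronglyMeasurable
    rw [h1]
    apply ENNReal.toReal_le_of_le_ofReal (by positivity)
    rw [eLpNorm_one_eq_lintegral_enorm] at hfg
    exact hfg
  have hfd : Differentiable ℝ f := hf.differentiable (by simp)
  have hfc : Continuous (deriv f) := hf.continuous_deriv (by simp)
  set D := ‖f 1‖ + ‖f a‖ + ∫ t in a..1, ‖deriv f t‖ with hD
  have hD0 : 0 ≤ D := by
    have : 0 ≤ ∫ t in a..1, ‖deriv f t‖ :=
      intervalIntegral.integral_nonneg ha1.le (fun _ _ => norm_nonneg _)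
    positivity
  refine ⟨max (max r₀ r₁) (4 * M' * D / δ), fun r hr => ?_⟩
  have hrr0 : r₀ ≤ r := ((le_max_left _ _).trans (le_max_left _ _)).trans hr.le
  have hrr1 : r₁ ≤ r := ((le_max_right _ _).trans (le_max_left _ _)).trans hr.le
  have hrr2 : 4 * M' * D / δ ≤ r := (le_max_right _ _).trans hr.le
  have hrp : 0 < r := hr₀.trans_le hrr0
  rw [dist_zero_right]
  have hsplit : ∫ t in Set.Ioo a 1, ((t ^ μ * bF μ (r ^ 2 / 4 * t) : ℝ) : ℂ) * g t =
      (∫ t in Set.Ioo a 1, ((t ^ μ * bF μ (r ^ 2 / 4 * t) : ℝ) : ℂ) * (g t - f t)) +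
      ∫ t in Set.Ioo a 1, ((t ^ μ * bF μ (r ^ 2 / 4 * t) : ℝ) : ℂ) * f t := by
    rw [← integral_add (bK_mul_integrable μ _ a ha _ hgf) (bK_mul_integrable μ _ a ha _ hfint)]
    congr 1; ext t; ring
  rw [hsplit, mul_add]
  have hpart1 : ‖((r ^ (μ + 1 / 2) : ℝ) : ℂ) *
      ∫ t in Set.Ioo a 1, ((t ^ μ * bF μ (r ^ 2 / 4 * t) : ℝ) : ℂ) * (g t - f t)‖ ≤ δ / 4 := by
    rw [← integral_const_mul]
    calc _ ≤ ∫ t in Set.Ioo a 1, M * ‖g t - f t‖ := by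
          apply norm_integral_le_of_norm_le (hgf.norm.const_mul M)
          filter_upwards [ae_restrict_mem measurableSet_Ioo] with t ht
          rw [← mul_assoc, norm_mul, ← Complex.ofReal_mul, Complex.norm_real, Real.norm_eq_abs]
          gcongr
          exact hb r hrr0 t (Set.Ioo_subset_Icc_self ht)
      _ = M * ∫ t in Set.Ioo a 1, ‖g t - f t‖ := integral_const_mul _ _
      _ ≤ M * (δ / (4 * M)) := by gcongr
      _ = δ / 4 := by field_simp
  have hpart2 : ‖((r ^ (μ + 1 / 2) : ℝ) : ℂ) *
      ∫ t in Set.Ioo a 1, ((t ^ μ * bF μ (r ^ 2 / 4 * t) : ℝ) : ℂ) * f t‖ ≤ δ / 4 := by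
    rw [← integral_Ioc_eq_integral_Ioo, ← intervalIntegral.integral_of_le ha1.le]
    set U : ℝ → ℂ := fun t => ((t ^ (μ + 1) * bF (μ + 1) (r ^ 2 / 4 * t) : ℝ) : ℂ) with hU
    have hUb : ∀ t ∈ Set.Icc a 1, ‖((r ^ (μ + 1 / 2) : ℝ) : ℂ) * U t‖ ≤ M' / r := by
      intro t ht
      have := hb' r hrr1 t ht
      rw [hU, ← Complex.ofReal_mul, Complex.norm_real, Real.norm_eq_abs, le_div_iff₀ hrp]
      convert! this using 1
      rw [show μ + 1 + 1 / 2 = (μ + 1 / 2) + 1 by ring, Real.rpow_add hrp (μ + 1 / 2), Real.rpow_one,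
        ← abs_of_pos hrp, ← abs_mul, abs_of_pos hrp]
      congr 1; ring
    have hUc : ContinuousOn U (Set.Icc a 1) :=
      Complex.continuous_ofReal.comp_continuousOn (bK_cont (μ + 1) _ a ha)
    have hibp := intervalIntegral.integral_deriv_mul_eq_sub (a := a) (b := 1)
      (u := U) (u' := fun t => ((t ^ μ * bF μ (r ^ 2 / 4 * t) : ℝ) : ℂ)) (v := f) (v' := deriv f)
      ?_ ?_ ?_ ?_
    · have i1 : IntervalIntegrable
          (fun t => ((t ^ μ * bF μ (r ^ 2 / 4 * t) : ℝ) : ℂ) * f t) volume a 1 := by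
        rw [intervalIntegrable_iff_integrableOn_Ioo_of_le ha1.le]
        exact bK_mul_integrable μ _ a ha _ hfint
      have i2 : IntervalIntegrable (fun t => U t * deriv f t) volume a 1 := by
        apply ContinuousOn.intervalIntegrable
        rw [Set.uIcc_of_le ha1.le]
        exact hUc.mul hfc.continuousOn
      rw [intervalIntegral.integral_add i1 i2] at hibp
      rw [eq_sub_of_add_eq hibp, mul_sub, mul_sub, ← mul_assoc, ← mul_assoc]
      have b1 : ‖((r ^ (μ + 1 / 2) : ℝ) : ℂ) * U 1 * f 1‖ ≤ M' / r * ‖f 1‖ := by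
        rw [norm_mul]; gcongr; exact hUb 1 ⟨ha1.le, le_rfl⟩
      have b2 : ‖((r ^ (μ + 1 / 2) : ℝ) : ℂ) * U a * f a‖ ≤ M' / r * ‖f a‖ := by
        rw [norm_mul]; gcongr; exact hUb a ⟨le_rfl, ha1.le⟩
      have b3 : ‖((r ^ (μ + 1 / 2) : ℝ) : ℂ) * ∫ t in a..1, U t * deriv f t‖ ≤
          M' / r * ∫ t in a..1, ‖deriv f t‖ := by
        rw [← intervalIntegral.integral_const_mul, ← intervalIntegral.integral_const_mul]
        apply intervalIntegral.norm_integral_le_of_norm_le ha1.le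
        · refine Eventually.of_forall fun t ht => ?_
          rw [← mul_assoc, norm_mul]
          gcongr
          exact hUb t (Set.Ioc_subset_Icc_self ht)
        · exact (continuous_const.mul hfc.norm).intervalIntegrable _ _
      calc _ ≤ M' / r * ‖f 1‖ + M' / r * ‖f a‖ + M' / r * ∫ t in a..1, ‖deriv f t‖ := by
            refine (norm_sub_le _ _).trans (add_le_add ((norm_sub_le _ _).trans (add_le_add b1 b2)) b3)
        _ = M' * D / r := by rw [hD]; ring
        _ ≤ δ / 4 := by
          rw [div_le_iff₀ hδ] at hrr2
          rw [div_le_iff₀ hrp]; linarith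
    · intro t ht
      rw [Set.uIcc_of_le ha1.le] at ht
      exact (bK_hasDerivAt μ _ t (ha.trans_le ht.1)).ofReal_comp
    · intro t _
      exact (hfd t).hasDerivAt
    · apply ContinuousOn.intervalIntegrable
      rw [Set.uIcc_of_le ha1.le]
      exact Complex.continuous_ofReal.comp_continuousOn (bK_cont μ _ a ha)
    · exact hfc.intervalIntegrable _ _
  have := norm_add_le (((r ^ (μ + 1 / 2) : ℝ) : ℂ) *
      ∫ t in Set.Ioo a 1, ((t ^ μ * bF μ (r ^ 2 / 4 * t) : ℝ) : ℂ) * (g t - f t))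
      (((r ^ (μ + 1 / 2) : ℝ) : ℂ) *
      ∫ t in Set.Ioo a 1, ((t ^ μ * bF μ (r ^ 2 / 4 * t) : ℝ) : ℂ) * f t)
  linarith

lemma cpow_norm_le_one (Λ : ℂ) (hΛ : 0 ≤ Λ.re) (t : ℝ) (ht : t ∈ Set.Ioo (0:ℝ) 1) :
    ‖((1 - t : ℝ) : ℂ) ^ Λ‖ ≤ 1 := by
  rw [Complex.norm_cpow_eq_rpow_re_of_pos (by linarith [ht.2])]
  exact Real.rpow_le_one (by linarith [ht.2]) (by linarith [ht.1]) hΛ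

lemma cpow_mul_integrable (Λ : ℂ) (hΛ : 0 ≤ Λ.re) (a : ℝ) (ha : 0 < a) (g : ℝ → ℂ)
    (hg : IntegrableOn g (Set.Ioo 0 1)) :
    IntegrableOn (fun t : ℝ => ((1 - t : ℝ) : ℂ) ^ Λ * g t) (Set.Ioo a 1) := by
  have hsub : Set.Ioo a 1 ⊆ Set.Ioo 0 1 := Set.Ioo_subset_Ioo_left ha.le
  refine Integrable.bdd_mul (c := 1) (hg.mono_set hsub) ?_ ?_
  · apply Measurable.aestronglyMeasurable
    fun_prop
  · filter_upwards [ae_restrict_mem measurableSet_Ioo] with t ht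
    exact cpow_norm_le_one Λ hΛ t (hsub ht)

lemma ibp_step (Λ : ℂ) (hΛ : 1 ≤ Λ.re) (Ψ : ℕ → ℝ → ℂ) (a ε : ℝ) (ha : 0 < a) (haε : a < ε)
    (hε : ε < 1) (hd : ∀ t ∈ Set.Ioo (0:ℝ) 1, HasDerivAt (Ψ 0) (Ψ 1 t) t)
    (h0 : ∀ t ∈ Set.Ioo (0:ℝ) ε, Ψ 0 t = 0)
    (hint0 : IntegrableOn (Ψ 0) (Set.Ioo 0 1)) (hint1 : IntegrableOn (Ψ 1) (Set.Ioo 0 1))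
    (ν ρ : ℝ) :
    ∫ t in Set.Ioo a 1, ((t ^ ν * bF ν (ρ * t) : ℝ) : ℂ) * (((1 - t : ℝ) : ℂ) ^ Λ * Ψ 0 t) =
    - ∫ t in Set.Ioo a 1, ((t ^ (ν + 1) * bF (ν + 1) (ρ * t) : ℝ) : ℂ) *
      (((1 - t : ℝ) : ℂ) ^ (Λ - 1) * (- Λ * Ψ 0 t + ((1 - t : ℝ) : ℂ) * Ψ 1 t)) := by
  have ha1 : a < 1 := haε.trans hε
  have hsub : Set.Ioo a 1 ⊆ Set.Ioo 0 1 := Set.Ioo_subset_Ioo_left ha.le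
  have hΛ1 : 0 ≤ (Λ - 1).re := by simp; linarith
  have hnew : IntegrableOn (fun t : ℝ => - Λ * Ψ 0 t + ((1 - t : ℝ) : ℂ) * Ψ 1 t)
      (Set.Ioo 0 1) := by
    apply Integrable.add (hint0.const_mul _)
    refine Integrable.bdd_mul (c := 1) hint1 ?_ ?_
    · exact Continuous.aestronglyMeasurable (by fun_prop)
    · filter_upwards [ae_restrict_mem measurableSet_Ioo] with t ht
      rw [Complex.norm_real, Real.norm_eq_abs, abs_of_pos (by linarith [ht.2])]
      linarith [ht.1]
  have i1 := bK_mul_integrable ν ρ a ha _ (cpow_mul_integrable Λ (by linarith) a ha _ hint0)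
  have i2 := bK_mul_integrable (ν + 1) ρ a ha _ (cpow_mul_integrable (Λ - 1) hΛ1 a ha _ hnew)
  rw [eq_neg_iff_add_eq_zero, ← integral_add i1 i2, ← integral_Ioc_eq_integral_Ioo,
    ← intervalIntegral.integral_of_le ha1.le]
  have key := intervalIntegral.integral_eq_sub_of_hasDerivAt_of_tendsto (E := ℂ) ha1
    (f := fun t : ℝ => ((t ^ (ν + 1) * bF (ν + 1) (ρ * t) : ℝ) : ℂ) *
      (((1 - t : ℝ) : ℂ) ^ Λ * Ψ 0 t))
    (f' := fun t : ℝ => ((t ^ ν * bF ν (ρ * t) : ℝ) : ℂ) * (((1 - t : ℝ) : ℂ) ^ Λ * Ψ 0 t) +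
      ((t ^ (ν + 1) * bF (ν + 1) (ρ * t) : ℝ) : ℂ) *
      (((1 - t : ℝ) : ℂ) ^ (Λ - 1) * (- Λ * Ψ 0 t + ((1 - t : ℝ) : ℂ) * Ψ 1 t)))
    (fa := 0) (fb := 0) ?_ ?_ ?_ ?_
  · rw [key, sub_zero]
  · intro t ht
    have ht01 := hsub ht
    have h1t : 0 < 1 - t := by linarith [ht.2]
    have hK := (bK_hasDerivAt ν ρ t ht01.1).ofReal_comp
    have hne : ((1 - t : ℝ) : ℂ) ≠ 0 := by exact_mod_cast h1t.ne'
    have hlin : HasDerivAt (fun t : ℝ => ((1 - t : ℝ) : ℂ)) (-1) t := by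
      have := ((hasDerivAt_id t).const_sub 1).ofReal_comp
      simpa using this
    have hp : HasDerivAt (fun t : ℝ => ((1 - t : ℝ) : ℂ) ^ Λ)
        (Λ * ((1 - t : ℝ) : ℂ) ^ (Λ - 1) * (-1)) t := by
      have hq : HasDerivAt (fun z : ℂ => z ^ Λ) (Λ * ((1 - t : ℝ) : ℂ) ^ (Λ - 1))
          ((1 - t : ℝ) : ℂ) := by
        have := (hasDerivAt_id ((1 - t : ℝ) : ℂ)).cpow_const (c := Λ)
          (Or.inl (by simpa using ht.2))
        simpa using this
      exact hq.comp t hlin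
    have := hK.mul (hp.mul (hd t ht01))
    convert! this using 1
    have e : ((1 - t : ℝ) : ℂ) ^ Λ = ((1 - t : ℝ) : ℂ) ^ (Λ - 1) * ((1 - t : ℝ) : ℂ) := by
      rw [Complex.cpow_sub _ _ hne, Complex.cpow_one, div_mul_cancel₀ _ hne]
    simp only [Pi.mul_apply, e]
    ring
  · rw [intervalIntegrable_iff_integrableOn_Ioo_of_le ha1.le]
    exact i1.add i2
  · apply tendsto_const_nhds.congr'
    filter_upwards [Ioo_mem_nhdsGT haε] with t ht
    rw [h0 t ⟨ha.trans ht.1, ht.2⟩]; simp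
  · set B := ∫ t in Set.Ioo (0:ℝ) 1, ‖Ψ 1 t‖ with hB
    have hbd : ∀ t ∈ Set.Ioo a 1, ‖Ψ 0 t‖ ≤ B := by
      intro t ht
      have hI : Set.Icc a t ⊆ Set.Ioo 0 1 := fun s hs => ⟨ha.trans_le hs.1, hs.2.trans_lt ht.2⟩
      have hi : IntervalIntegrable (Ψ 1) volume a t := by
        rw [intervalIntegrable_iff_integrableOn_Icc_of_le ht.1.le]
        exact hint1.mono_set hI
      have := intervalIntegral.integral_eq_sub_of_hasDerivAt (f := Ψ 0) (f' := Ψ 1) (a := a)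
        (b := t) (fun s hs => hd s (hI (by rwa [Set.uIcc_of_le ht.1.le] at hs))) hi
      rw [h0 a ⟨ha, haε⟩, sub_zero] at this
      rw [← this]
      refine (intervalIntegral.norm_integral_le_integral_norm ht.1.le).trans ?_
      rw [intervalIntegral.integral_of_le ht.1.le]
      apply setIntegral_mono_set hint1.norm
      · exact Eventually.of_forall fun _ => norm_nonneg _
      · exact (Set.Ioc_subset_Icc_self.trans hI).eventuallyLE
    have hz : Tendsto (fun t : ℝ => ((1 - t : ℝ) : ℂ) ^ Λ * Ψ 0 t) (𝓝[<] 1) (𝓝 0) := by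
      have hl : Tendsto (fun t : ℝ => (1 - t) * B) (𝓝[<] 1) (𝓝 0) := by
        have : Continuous (fun t : ℝ => (1 - t) * B) := by fun_prop
        have := this.tendsto 1
        simp only [sub_self, zero_mul] at this
        exact this.mono_left nhdsWithin_le_nhds
      refine squeeze_zero_norm' ?_ hl
      filter_upwards [Ioo_mem_nhdsLT ha1] with t ht
      have h1t : 0 < 1 - t := by linarith [ht.2]
      rw [norm_mul, Complex.norm_cpow_eq_rpow_re_of_pos h1t]
      have h1 : (1 - t) ^ Λ.re ≤ 1 - t := by
        have := Real.rpow_le_rpow_of_exponent_ge h1t (by linarith [ht.1]) hΛ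
        rwa [Real.rpow_one] at this
      have := hbd t ht
      gcongr
    have hKc := (bK_hasDerivAt ν ρ 1 one_pos).ofReal_comp.continuousAt.tendsto
    have := (hKc.mono_left (nhdsWithin_le_nhds (s := Set.Iio 1))).mul hz
    rw [mul_zero] at this
    exact this

lemma main_ind (a ε : ℝ) (ha : 0 < a) (haε : a < ε) (hε : ε < 1) (N : ℕ) :
    ∀ (Λ : ℂ) (_ : (N : ℝ) ≤ Λ.re) (Ψ : ℕ → ℝ → ℂ)
    (_ : ∀ k, ∀ t ∈ Set.Ioo (0:ℝ) 1, HasDerivAt (Ψ k) (Ψ (k + 1) t) t)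
    (_ : ∀ k, ∀ t ∈ Set.Ioo (0:ℝ) ε, Ψ k t = 0)
    (_ : ∀ k ≤ N, IntegrableOn (Ψ k) (Set.Ioo 0 1)) (ν : ℝ),
    Tendsto (fun r : ℝ => ((r ^ (ν + N + 1 / 2) : ℝ) : ℂ) *
      ∫ t in Set.Ioo a 1, ((t ^ ν * bF ν (r ^ 2 / 4 * t) : ℝ) : ℂ) *
        (((1 - t : ℝ) : ℂ) ^ Λ * Ψ 0 t)) atTop (𝓝 0) := by
  induction N with
  | zero =>
    intro Λ hΛ Ψ hd h0 hint ν
    have := bK_riemannLebesgue ν a ha (haε.trans hε) _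
      (cpow_mul_integrable Λ (by simpa using hΛ) a ha _ (hint 0 le_rfl))
    simpa using this
  | succ N ih =>
    intro Λ hΛ Ψ hd h0 hint ν
    push_cast at hΛ
    have hN : (0:ℝ) ≤ N := Nat.cast_nonneg N
    have := ih (Λ - 1) (by simp; linarith)
      (fun k t => - (Λ + k) * Ψ k t + ((1 - t : ℝ) : ℂ) * Ψ (k + 1) t) ?_ ?_ ?_ (ν + 1)
    · have := this.neg
      rw [neg_zero] at this
      refine this.congr fun r => ?_
      rw [ibp_step Λ (by linarith) Ψ a ε ha haε hε (hd 0) (h0 0) (hint 0 (by omega))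
        (hint 1 (by omega)) ν (r ^ 2 / 4), mul_neg]
      push_cast
      simp only [add_zero, zero_add]
      rw [show ν + 1 + (N : ℝ) + 1 / 2 = ν + (N + 1) + 1 / 2 by ring]
    · intro k t ht
      have hlin : HasDerivAt (fun t : ℝ => ((1 - t : ℝ) : ℂ)) (-1) t := by
        have := ((hasDerivAt_id t).const_sub 1).ofReal_comp
        simpa using this
      have := ((hd k t ht).const_mul (-(Λ + k))).add (hlin.mul (hd (k + 1) t ht))
      convert! this using 1
      push_cast
      ring
    · intro k t ht
      simp [h0 k t ht, h0 (k + 1) t ht]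
    · intro k hk
      apply Integrable.add ((hint k (by omega)).const_mul _)
      refine Integrable.bdd_mul (c := 1) (hint (k + 1) (by omega)) ?_ ?_
      · exact Continuous.aestronglyMeasurable (by fun_prop)
      · filter_upwards [ae_restrict_mem measurableSet_Ioo] with t ht
        rw [Complex.norm_real, Real.norm_eq_abs, abs_of_pos (by linarith [ht.2])]
        linarith [ht.1]

/-- Let `N ∈ ℕ₀`, `Λ ∈ ℂ` with `Re Λ ≥ N`, `0 < ε < 1`.  Let `ψ` be smooth on `(0,1)`,
vanishing on `(0,ε)`, with `ψ^{(k)}` integrable on `(0,1)` for `0 ≤ k ≤ N`, and set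
`φ(t) = (1-t)^Λ ψ(t)`.  Then for real `ν ≥ -N`,
`∫₀¹ s^{ν+1} φ(s²) J_ν(rs) ds = o(r^{-(N+1/2)})` as `r → ∞`. -/
theorem finite_hankel_boundary_decay (N : ℕ) (Λ : ℂ) (hΛ : (N : ℝ) ≤ Λ.re)
    (ε : ℝ) (hε : 0 < ε) (hε' : ε < 1)
    (ψ : ℝ → ℂ) (hψ : ContDiffOn ℝ (⊤ : ℕ∞) ψ (Set.Ioo 0 1))
    (hψ0 : ∀ t ∈ Set.Ioo (0:ℝ) ε, ψ t = 0)
    (hψint : ∀ k : ℕ, k ≤ N →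
      IntegrableOn (iteratedDerivWithin k ψ (Set.Ioo 0 1)) (Set.Ioo (0:ℝ) 1))
    (φ : ℝ → ℂ) (hφ : ∀ t : ℝ, φ t = ((1 - t : ℝ) : ℂ) ^ Λ * ψ t)
    (ν : ℝ) (hν : -(N : ℝ) ≤ ν) :
    (fun r : ℝ =>
        ∫ s in (0:ℝ)..1, ((s ^ (ν + 1) : ℝ) : ℂ) * φ (s ^ 2) * besselJ (ν : ℂ) (r * s))
      =o[atTop] fun r : ℝ => r ^ (-((N : ℝ) + 1 / 2)) := by

  set Ψ : ℕ → ℝ → ℂ := fun k => iteratedDerivWithin k ψ (Set.Ioo 0 1) with hΨ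
  have hud : UniqueDiffOn ℝ (Set.Ioo (0:ℝ) 1) := isOpen_Ioo.uniqueDiffOn
  have hd : ∀ k, ∀ t ∈ Set.Ioo (0:ℝ) 1, HasDerivAt (Ψ k) (Ψ (k + 1) t) t := by
    intro k t ht
    have h1 : DifferentiableOn ℝ (Ψ k) (Set.Ioo 0 1) :=
      hψ.differentiableOn_iteratedDerivWithin (by exact_mod_cast WithTop.coe_lt_top _) hud
    have h2 := (h1 t ht).hasDerivWithinAt.hasDerivAt (isOpen_Ioo.mem_nhds ht)
    simp only [hΨ, iteratedDerivWithin_succ]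
    exact h2
  have hz : ∀ k, ∀ t ∈ Set.Ioo (0:ℝ) ε, Ψ k t = 0 := by
    intro k
    induction k with
    | zero => intro t ht; simpa [hΨ] using hψ0 t ht
    | succ k ih =>
      intro t ht
      have h1 := hd k t ⟨ht.1, ht.2.trans hε'⟩
      have h2 : HasDerivAt (Ψ k) 0 t := by
        apply (hasDerivAt_const t (0:ℂ)).congr_of_eventuallyEq
        filter_upwards [isOpen_Ioo.mem_nhds ht] with s hs
        exact ih s hs
      exact h1.unique h2
  have key := main_ind (ε / 2) ε (by positivity) (by linarith) hε' N Λ hΛ Ψ hd hz hψint ν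
  have hΨ0 : Ψ 0 = ψ := by simp [hΨ]
  rw [hΨ0] at key
  have hI : ∀ r : ℝ, 0 < r →
      ∫ s in (0:ℝ)..1, ((s ^ (ν + 1) : ℝ) : ℂ) * φ (s ^ 2) * besselJ (ν : ℂ) (r * s) =
      (((1 / 2) * (r / 2) ^ ν : ℝ) : ℂ) *
      ∫ t in Set.Ioo (ε / 2) 1, ((t ^ ν * bF ν (r ^ 2 / 4 * t) : ℝ) : ℂ) *
        (((1 - t : ℝ) : ℂ) ^ Λ * ψ t) := by
    intro r hr
    have himg : (fun s : ℝ => s ^ 2) '' Set.Ioo (0:ℝ) 1 = Set.Ioo 0 1 := by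
      ext t
      constructor
      · rintro ⟨s, hs, rfl⟩
        exact ⟨by have := hs.1; positivity, by have := hs.1; have := hs.2; simp only; nlinarith⟩
      · intro ht
        refine ⟨Real.sqrt t, ⟨Real.sqrt_pos.mpr ht.1, ?_⟩, Real.sq_sqrt ht.1.le⟩
        rw [Real.sqrt_lt' one_pos]; simpa using ht.2
    have hcv := integral_image_eq_integral_abs_deriv_smul (s := Set.Ioo (0:ℝ) 1)
      (f := fun s => s ^ 2) (f' := fun s => 2 * s) measurableSet_Ioo
      (fun s _ => by simpa using (hasDerivAt_pow 2 s).hasDerivWithinAt)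
      (fun s hs s' hs' h => by
        exact (pow_left_inj₀ hs.1.le hs'.1.le two_ne_zero).mp h)
      (fun t => ((t ^ ν * bF ν (r ^ 2 / 4 * t) : ℝ) : ℂ) * (((1 - t : ℝ) : ℂ) ^ Λ * ψ t))
    rw [himg] at hcv
    have hsub : ∫ t in Set.Ioo (ε / 2) 1, ((t ^ ν * bF ν (r ^ 2 / 4 * t) : ℝ) : ℂ) *
        (((1 - t : ℝ) : ℂ) ^ Λ * ψ t) = ∫ t in Set.Ioo 0 1,
        ((t ^ ν * bF ν (r ^ 2 / 4 * t) : ℝ) : ℂ) * (((1 - t : ℝ) : ℂ) ^ Λ * ψ t) := by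
      symm
      apply setIntegral_eq_of_subset_of_forall_sdiff_eq_zero measurableSet_Ioo
        (Set.Ioo_subset_Ioo_left (by positivity))
      rintro t ⟨ht, hnt⟩
      have : t < ε := by
        by_contra hc
        exact hnt ⟨by linarith, ht.2⟩
      rw [hψ0 t ⟨ht.1, this⟩]; simp
    rw [hsub, hcv, intervalIntegral.integral_of_le zero_le_one, integral_Ioc_eq_integral_Ioo,
      ← integral_const_mul]
    apply setIntegral_congr_fun measurableSet_Ioo
    intro s hs
    have hsp := hs.1
    simp only
    rw [besselJ_eq_s12 ν (r * s) (by positivity), hφ, abs_of_pos (by positivity), Complex.real_smul,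
      show (r * s) ^ 2 / 4 = r ^ 2 / 4 * s ^ 2 by ring, show r * s / 2 = (r / 2) * s by ring,
      Real.mul_rpow (by positivity) hsp.le, Real.rpow_add hsp, Real.rpow_one,
      show (s ^ 2 : ℝ) ^ ν = s ^ ν * s ^ ν by rw [pow_two, Real.mul_rpow hsp.le hsp.le]]
    push_cast
    ring
  rw [Asymptotics.isLittleO_iff]
  intro c hc
  have hp2 : (0:ℝ) < 2 ^ ν := by positivity
  have hev := (tendsto_zero_iff_norm_tendsto_zero.mp key).eventually_lt_const
    (by positivity : 0 < c * 2 ^ ν)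
  filter_upwards [hev, eventually_gt_atTop 0] with r h1 hr
  rw [hI r hr]
  rw [norm_mul, Complex.norm_real, Real.norm_eq_abs, abs_of_pos (by positivity)] at h1 ⊢
  rw [Real.norm_eq_abs, abs_of_pos (by positivity), Real.div_rpow hr.le (by norm_num),
    Real.rpow_neg hr.le]
  rw [show ν + (N : ℝ) + 1 / 2 = ν + (N + 1 / 2) by ring, Real.rpow_add hr] at h1
  generalize ‖∫ t in Set.Ioo (ε / 2) 1, ((t ^ ν * bF ν (r ^ 2 / 4 * t) : ℝ) : ℂ) *
        (((1 - t : ℝ) : ℂ) ^ Λ * ψ t)‖ = J at *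
  have hq : 0 < r ^ ((N : ℝ) + 1 / 2) := by positivity
  rw [← div_eq_mul_inv, le_div_iff₀ hq]
  have : 1 / 2 * (r ^ ν / 2 ^ ν) * J * r ^ ((N : ℝ) + 1 / 2) =
    (r ^ ν * r ^ ((N : ℝ) + 1 / 2) * J) / 2 ^ ν / 2 := by ring
  rw [this]
  have h2 : (r ^ ν * r ^ ((N : ℝ) + 1 / 2) * J) / 2 ^ ν ≤ c := by
    rw [div_le_iff₀ hp2]; exact h1.le
  linarith
end
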